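/- Let β be a cyclotomic integer expressible as a sum of four complex roots of unity. Then the degree of the field extension [ℚ(ζ_{c(β)}) : ℚ(β)] is at most 6. -/

import Mathlib

open CategoryTheory

/-- `z` is a complex root of unity. -/
def IsRootOfUnity (z : ℂ) : Prop := ∃ n : ℕ, 0 < n ∧ z ^ n = 1

/-- The `n`-th cyclotomic field `ℚ(ζ_n)`, realized as the subfield of `ℂ` generated by
all `n`-th roots of unity. -/
noncomputable def cycField (n : ℕ) : Subfield ℂ := Subfield.closure {z : ℂ | z ^ n = 1}

/-- The conductor of a set `S` of cyclotomic integers: the smallest positive integer `n`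
such that `S ⊆ ℚ(ζ_n)`. -/
noncomputable def conductorOf (S : Set ℂ) : ℕ := sInf {n : ℕ | 0 < n ∧ S ⊆ (cycField n : Set ℂ)}

section PrimaryPart

/-- An exponent congruent to `1` modulo the `p`-part of `N` and to `0` modulo the prime-to-`p`
part of `N`. -/
def primaryExponent (N p : ℕ) : ℕ := ordCompl[p] N ^ (ordProj[p] N).totient

/-- The `p`-primary component of an `N`-th root of unity `x`. -/
def primaryPart {M : Type*} [Monoid M] (N p : ℕ) (x : M) : M := x ^ primaryExponent N p

theorem primaryExponent_modEq_one {N p : ℕ} (hN : N ≠ 0) (hp : p.Prime) :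
    primaryExponent N p ≡ 1 [MOD ordProj[p] N] :=
  Nat.ModEq.pow_totient ((Nat.coprime_ordCompl hp hN).symm.pow_right _)

theorem ordCompl_dvd_primaryExponent {N p : ℕ} (hp : p.Prime) :
    ordCompl[p] N ∣ primaryExponent N p :=
  dvd_pow_self _ (Nat.totient_pos.2 (pow_pos hp.pos _)).ne'

theorem dvd_ordProj {N p : ℕ} (hN : N ≠ 0) (hp : p.Prime) (hpN : p ∣ N) : p ∣ ordProj[p] N :=
  dvd_pow_self _ (hp.factorization_pos_of_dvd hN hpN).ne'

theorem primaryPart_mul {M : Type*} [CommMonoid M] (N p : ℕ) (x y : M) :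
    primaryPart N p (x * y) = primaryPart N p x * primaryPart N p y :=
  mul_pow _ _ _

theorem primaryPart_pow_ordProj {M : Type*} [Monoid M] {N p : ℕ} (hp : p.Prime) {x : M}
    (hx : x ^ N = 1) : primaryPart N p x ^ ordProj[p] N = 1 := by
  obtain ⟨k, hk⟩ := ordCompl_dvd_primaryExponent (N := N) hp
  rw [primaryPart, ← pow_mul, hk, mul_comm, ← mul_assoc, Nat.ordProj_mul_ordCompl_eq_self,
    pow_mul, hx, one_pow]

theorem primaryPart_self {M : Type*} [Monoid M] {N p : ℕ} (hN : N ≠ 0) (hp : p.Prime)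
    (hpN : p ∣ N) {x : M} (hx : x ^ p = 1) : primaryPart N p x = x := by
  have := pow_eq_pow_of_modEq
    ((primaryExponent_modEq_one hN hp).of_dvd (dvd_ordProj hN hp hpN)) hx
  rwa [pow_one] at this

theorem primaryPart_of_ne {M : Type*} [Monoid M] {N p q : ℕ} (hp : p.Prime) (hq : q.Prime)
    (hpq : p ≠ q) (hpN : p ∣ N) {x : M} (hx : x ^ p = 1) : primaryPart N q x = 1 := by
  have h1 : p ∣ ordCompl[q] N := by
    have h := hpN
    rw [← Nat.ordProj_mul_ordCompl_eq_self N q] at h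
    rcases hp.dvd_mul.1 h with h | h
    · exact absurd ((Nat.prime_dvd_prime_iff_eq hp hq).1 (hp.dvd_of_dvd_pow h)) hpq
    · exact h
  obtain ⟨k, hk⟩ := h1.trans (ordCompl_dvd_primaryExponent (N := N) hq)
  rw [primaryPart, hk, pow_mul, hx, one_pow]

theorem map_primaryPart {M M' F : Type*} [Monoid M] [Monoid M'] [FunLike F M M']
    [MonoidHomClass F M M'] (f : F) (N p : ℕ) (x : M) :
    f (primaryPart N p x) = primaryPart N p (f x) :=
  map_pow _ _ _

variable {L : Type*} [Field L]

theorem ne_zero_of_pow_eq_one {N : ℕ} (hN : N ≠ 0) {x : L} (hx : x ^ N = 1) : x ≠ 0 := by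
  rintro rfl
  simp [hN] at hx

theorem eq_of_primaryPart_eq {N : ℕ} (hN : N ≠ 0) {x y : L} (hx : x ^ N = 1) (hy : y ^ N = 1)
    (h : ∀ q : ℕ, q.Prime → q ∣ N → primaryPart N q x = primaryPart N q y) : x = y := by
  have hy0 := ne_zero_of_pow_eq_one hN hy
  have hz : (x / y) ^ N = 1 := by rw [div_pow, hx, hy, div_one]
  by_contra hne
  have h1 : orderOf (x / y) ≠ 1 := by
    rw [Ne, orderOf_eq_one_iff]
    intro h
    exact hne ((div_eq_one_iff_eq hy0).1 h)
  obtain ⟨q, hq, hqd⟩ := Nat.exists_prime_and_dvd h1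
  have hqN : q ∣ N := hqd.trans (orderOf_dvd_of_pow_eq_one hz)
  have h2 : (x / y) ^ primaryExponent N q = 1 := by
    rw [div_pow]
    have := h q hq hqN
    unfold primaryPart at this
    rw [this, div_self (pow_ne_zero _ hy0)]
  have h3 : q ∣ primaryExponent N q := hqd.trans (orderOf_dvd_of_pow_eq_one h2)
  have h4 := ((primaryExponent_modEq_one hN hq).of_dvd (dvd_ordProj hN hq hqN))
  have h5 : (1 : ℕ) ≡ 0 [MOD q] := h4.symm.trans ((Nat.modEq_zero_iff_dvd).2 h3)
  exact hq.one_lt.ne' (Nat.dvd_one.1 ((Nat.modEq_zero_iff_dvd).1 h5))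

theorem primaryPart_neg_of_ne_two {N p : ℕ} (hN2 : 2 ∣ N) (hp : p.Prime) (hp2 : p ≠ 2)
    (x : L) : primaryPart N p (-x) = primaryPart N p x := by
  rw [neg_eq_neg_one_mul, primaryPart_mul,
    primaryPart_of_ne Nat.prime_two hp hp2.symm hN2 (by norm_num), one_mul]

theorem primaryPart_two_neg {N : ℕ} (hN : N ≠ 0) (hN2 : 2 ∣ N) (x : L) :
    primaryPart N 2 (-x) = -primaryPart N 2 x := by
  rw [neg_eq_neg_one_mul, primaryPart_mul,
    primaryPart_self hN Nat.prime_two hN2 (by norm_num), neg_one_mul]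

end PrimaryPart

section Relations

variable {L : Type*} [Field L]

theorem sum_range_pow_of_pow_eq_one {q : ℕ} {w : L} (hw : w ^ q = 1) [Decidable (w = 1)] :
    ∑ k ∈ Finset.range q, w ^ k = if w = 1 then (q : L) else 0 := by
  split_ifs with h
  · simp [h]
  · rw [geom_sum_eq h, hw, sub_self, zero_div]

/-- The Ramanujan sum of prime power modulus. -/
theorem sum_range_pow_not_dvd {p r : ℕ} (hp : p.Prime) {w : L} (hw : w ^ (p * r) = 1)
    [Decidable (w = 1)] [Decidable (w ^ p = 1)] :
    ∑ k ∈ Finset.range (p * r) with ¬ p ∣ k, w ^ k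
      = (if w = 1 then ((p * r : ℕ) : L) else 0) - (if w ^ p = 1 then (r : L) else 0) := by
  rw [← sum_range_pow_of_pow_eq_one hw,
    ← sum_range_pow_of_pow_eq_one (q := r) (w := w ^ p) (by rw [← pow_mul, hw]),
    ← Finset.sum_filter_add_sum_filter_not (Finset.range (p * r)) (p ∣ ·), eq_sub_iff_add_eq,
    add_comm]
  congr 1
  refine Finset.sum_bij' (fun j _ => p * j) (fun k _ => k / p) ?_ ?_ ?_ ?_ ?_
  · intro j hj
    simp only [Finset.mem_range, Finset.mem_filter] at hj ⊢
    exact ⟨Nat.mul_lt_mul_of_pos_left hj hp.pos, dvd_mul_right _ _⟩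
  · intro k hk
    simp only [Finset.mem_range, Finset.mem_filter] at hk ⊢
    exact Nat.div_lt_of_lt_mul hk.1
  · intro j _
    exact Nat.mul_div_cancel_left _ hp.pos
  · intro k hk
    exact Nat.mul_div_cancel' (Finset.mem_filter.1 hk).2
  · intro j _
    rw [pow_mul]

variable [CharZero L]

open Polynomial in
theorem sum_pow_eq_zero_of_coprime {N : ℕ} (hN : N ≠ 0) {ζ : L} (hζ : IsPrimitiveRoot ζ N)
    (s : Finset L) (hs : ∀ x ∈ s, x ^ N = 1) (c : L → ℚ) (h : ∑ x ∈ s, (c x : L) * x = 0)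
    {k : ℕ} (hk : k.Coprime N) : ∑ x ∈ s, (c x : L) * x ^ k = 0 := by
  have : NeZero N := ⟨hN⟩
  have hlog : ∀ x : L, ∃ i : ℕ, x ∈ s → ζ ^ i = x := fun x => by
    by_cases hx : x ∈ s
    · obtain ⟨i, -, hi⟩ := hζ.eq_pow_of_pow_eq_one (hs x hx)
      exact ⟨i, fun _ => hi⟩
    · exact ⟨0, fun h => absurd h hx⟩
  choose i hi using hlog
  let P : ℚ[X] := ∑ x ∈ s, C (c x) * X ^ i x
  have hP : aeval ζ P = 0 := by
    rw [← h, map_sum]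
    refine Finset.sum_congr rfl fun x hx => ?_
    simp [hi x hx]
  have h1 : aeval (ζ ^ k) P = 0 := by
    have e1 := cyclotomic_eq_minpoly_rat hζ (Nat.pos_of_ne_zero hN)
    have e2 := cyclotomic_eq_minpoly_rat (hζ.pow_of_coprime k hk) (Nat.pos_of_ne_zero hN)
    have := minpoly.dvd ℚ ζ hP
    rw [← e1, e2] at this
    exact aeval_eq_zero_of_dvd_aeval_eq_zero this (minpoly.aeval ℚ _)
  rw [← h1, map_sum]
  refine Finset.sum_congr rfl fun x hx => ?_
  simp only [map_mul, map_pow, aeval_C, aeval_X, eq_ratCast]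
  rw [← pow_mul, mul_comm k, pow_mul, hi x hx]

open Classical in
/-- In a rational relation between `N`-th roots of unity, the contributions of the classes of
`p`-primary parts are, up to rotation, constant along the cosets of the `p`-th roots of unity. -/
theorem sum_filter_primaryPart_mul {N : ℕ} (hN : N ≠ 0) {ζ : L} (hζ : IsPrimitiveRoot ζ N)
    (s : Finset L) (hs : ∀ x ∈ s, x ^ N = 1) (c : L → ℚ) (h : ∑ x ∈ s, (c x : L) * x = 0)
    {p : ℕ} (hp : p.Prime) (hpN : p ∣ N) {ω : L} (hω : ω ^ p = 1) (u : L) :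
    ∑ x ∈ s with primaryPart N p x = u * ω, (c x : L) * x
      = ω * ∑ x ∈ s with primaryPart N p x = u, (c x : L) * x := by
  have hω0 := ne_zero_of_pow_eq_one hp.ne_zero hω
  obtain ⟨r, hr⟩ := dvd_ordProj hN hp hpN
  have hr0 : r ≠ 0 := by
    rintro rfl
    exact (pow_pos hp.pos _).ne' hr
  have hωq : ω ^ ordProj[p] N = 1 := by rw [hr, pow_mul, hω, one_pow]
  by_cases hu : u ^ ordProj[p] N = 1
  swap
  · rw [Finset.filter_false_of_mem, Finset.filter_false_of_mem]
    · simp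
    · rintro x hx rfl
      exact hu (primaryPart_pow_ordProj hp (hs x hx))
    · intro x hx hxu
      have := primaryPart_pow_ordProj hp (hs x hx)
      rw [hxu, mul_pow, hωq, mul_one] at this
      exact hu this
  -- the prime-to-`p` part
  let y : L → L := fun x => x / primaryPart N p x
  have hcop : Nat.Coprime (ordProj[p] N) (ordCompl[p] N) :=
    (Nat.coprime_ordCompl hp hN).pow_left _
  have hx0 : ∀ x ∈ s, primaryPart N p x ≠ 0 := fun x hx =>
    pow_ne_zero _ (ne_zero_of_pow_eq_one hN (hs x hx))
  have hy : ∀ x ∈ s, y x ^ ordCompl[p] N = 1 := by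
    intro x hx
    have : primaryPart N p x ^ ordCompl[p] N = x ^ ordCompl[p] N := by
      rw [primaryPart, ← pow_mul]
      refine pow_eq_pow_of_modEq ?_ (hs x hx)
      have := Nat.ModEq.mul_right' (ordCompl[p] N) (primaryExponent_modEq_one hN hp)
      rwa [Nat.ordProj_mul_ordCompl_eq_self, one_mul] at this
    rw [div_pow, this, div_self (pow_ne_zero _ (ne_zero_of_pow_eq_one hN (hs x hx)))]
  have key : ∀ k : ℕ, ¬ p ∣ k → ∑ x ∈ s, (c x : L) * y x * primaryPart N p x ^ k = 0 := by
    intro k hk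
    obtain ⟨k', hk1, hk2⟩ := Nat.chineseRemainder hcop k 1
    have hk' : k'.Coprime N := by
      rw [← Nat.ordProj_mul_ordCompl_eq_self N p]
      refine Nat.Coprime.mul_right ?_ ?_
      · refine Nat.Coprime.pow_right _ (Nat.Coprime.symm ((hp.coprime_iff_not_dvd).2 ?_))
        rwa [(hk1.of_dvd (dvd_ordProj hN hp hpN)).dvd_iff dvd_rfl]
      · rw [Nat.Coprime, hk2.gcd_eq, Nat.gcd_one_left]
    rw [← sum_pow_eq_zero_of_coprime hN hζ s hs c h hk']
    refine Finset.sum_congr rfl fun x hx => ?_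
    have e1 : x = y x * primaryPart N p x := (div_mul_cancel₀ _ (hx0 x hx)).symm
    have e2 : x ^ k' = y x * primaryPart N p x ^ k := by
      conv_lhs => rw [e1]
      rw [mul_pow, pow_eq_pow_of_modEq hk2 (hy x hx), pow_one,
        pow_eq_pow_of_modEq hk1 (primaryPart_pow_ordProj hp (hs x hx))]
    rw [e2, mul_assoc]
  have main : ∀ v : L, v ^ ordProj[p] N = 1 →
      (p : L) * ∑ x ∈ s with primaryPart N p x = v, (c x : L) * y x
        = ∑ x ∈ s with primaryPart N p x ^ p = v ^ p, (c x : L) * y x := by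
    intro v hv
    have hv0 : v ≠ 0 := ne_zero_of_pow_eq_one (pow_pos hp.pos _).ne' hv
    have h1 : ∑ k ∈ Finset.range (p * r) with ¬ p ∣ k,
        ∑ x ∈ s, (c x : L) * y x * (primaryPart N p x / v) ^ k = 0 := by
      refine Finset.sum_eq_zero fun k hk => ?_
      have := key k (Finset.mem_filter.1 hk).2
      rw [← zero_div (v ^ k), ← this, Finset.sum_div]
      exact Finset.sum_congr rfl fun x _ => by rw [div_pow, mul_div_assoc]
    rw [Finset.sum_comm] at h1
    have h2 : ∀ x ∈ s, ∑ k ∈ Finset.range (p * r) with ¬ p ∣ k,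
        (c x : L) * y x * (primaryPart N p x / v) ^ k
        = (r : L) * ((p : L) * (if primaryPart N p x = v then (c x : L) * y x else 0)
          - (if primaryPart N p x ^ p = v ^ p then (c x : L) * y x else 0)) := by
      intro x hx
      rw [← Finset.mul_sum, sum_range_pow_not_dvd hp (by
        rw [← hr, div_pow, hv, primaryPart_pow_ordProj hp (hs x hx), div_one]), div_pow]
      simp only [div_eq_one_iff_eq hv0, div_eq_one_iff_eq (pow_ne_zero p hv0)]
      push_cast
      split_ifs <;> ring
    rw [Finset.sum_congr rfl h2, ← Finset.mul_sum, mul_eq_zero,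
      or_iff_right (Nat.cast_ne_zero.2 hr0), Finset.sum_sub_distrib, ← Finset.mul_sum,
      sub_eq_zero] at h1
    rw [Finset.sum_filter, Finset.sum_filter]
    exact h1
  have e : ∑ x ∈ s with primaryPart N p x = u * ω, (c x : L) * y x
      = ∑ x ∈ s with primaryPart N p x = u, (c x : L) * y x := by
    have hp0 : (p : L) ≠ 0 := Nat.cast_ne_zero.2 hp.ne_zero
    apply mul_left_cancel₀ hp0
    rw [main u hu, main (u * ω) (by rw [mul_pow, hu, hωq, one_mul]), mul_pow u ω p, hω, mul_one]
  have f : ∀ v : L, ∑ x ∈ s with primaryPart N p x = v, (c x : L) * x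
      = v * ∑ x ∈ s with primaryPart N p x = v, (c x : L) * y x := by
    intro v
    rw [Finset.mul_sum]
    refine Finset.sum_congr rfl fun x hx => ?_
    obtain ⟨hxs, rfl⟩ := Finset.mem_filter.1 hx
    rw [← mul_assoc, mul_comm (primaryPart N p x), mul_assoc]
    congr 1
    exact (mul_div_cancel₀ _ (hx0 x hxs)).symm
  rw [f, f, e]
  ring

end Relations

section VanishingSums

variable {L : Type*} [Field L]

open Classical in
/-- The elements of `A` whose `p`-primary part is `u`. -/
noncomputable def classPart (N p : ℕ) (A : Multiset L) (u : L) : Multiset L :=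
  A.filter (primaryPart N p · = u)

/-- Some coset of the `p`-th roots of unity consists of `p`-primary parts of elements of `V`. -/
def CoversCoset (N p : ℕ) (V : Multiset L) : Prop :=
  ∃ u : L, ∀ ω : L, ω ^ p = 1 → ∃ x ∈ V, primaryPart N p x = u * ω

theorem mem_classPart {N p : ℕ} {A : Multiset L} {u x : L} :
    x ∈ classPart N p A u ↔ x ∈ A ∧ primaryPart N p x = u := by
  classical exact Multiset.mem_filter

theorem classPart_le (N p : ℕ) (A : Multiset L) (u : L) : classPart N p A u ≤ A := by
  classical exact Multiset.filter_le _ _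

theorem CoversCoset.mono {N p : ℕ} {V W : Multiset L} (h : CoversCoset N p V) (hVW : V ≤ W) :
    CoversCoset N p W := by
  obtain ⟨u, hu⟩ := h
  refine ⟨u, fun ω hω => ?_⟩
  obtain ⟨x, hx, hxu⟩ := hu ω hω
  exact ⟨x, Multiset.mem_of_le hVW hx, hxu⟩

/-- A multiset covering a coset of the `p`-th roots of unity has at least `p` elements. -/
theorem CoversCoset.le_card {N p : ℕ} (hN : N ≠ 0) (hp : p.Prime) (hpN : p ∣ N) {ζ : L}
    (hζ : IsPrimitiveRoot ζ N) {V : Multiset L} (hV : ∀ x ∈ V, x ^ N = 1)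
    (h : CoversCoset N p V) : p ≤ V.card := by
  classical
  obtain ⟨u, hu⟩ := h
  obtain ⟨d, hd⟩ := hpN
  have hω : IsPrimitiveRoot (ζ ^ d) p := hζ.pow (Nat.pos_of_ne_zero hN) (by rw [hd, mul_comm])
  have hu0 : u ≠ 0 := by
    obtain ⟨x, hx, hxu⟩ := hu 1 (one_pow _)
    rw [mul_one] at hxu
    rw [← hxu]
    exact pow_ne_zero _ (ne_zero_of_pow_eq_one hN (hV x hx))
  calc p = (Polynomial.nthRootsFinset p (1 : L)).card := hω.card_nthRootsFinset.symm
    _ ≤ (V.map fun x => primaryPart N p x / u).toFinset.card := by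
      refine Finset.card_le_card fun ω hω => ?_
      obtain ⟨x, hx, hxu⟩ := hu ω ((Polynomial.mem_nthRootsFinset hp.pos _).1 hω)
      rw [Multiset.mem_toFinset, Multiset.mem_map]
      exact ⟨x, hx, by rw [hxu, mul_div_cancel_left₀ _ hu0]⟩
    _ ≤ V.card := (Multiset.toFinset_card_le _).trans (Multiset.card_map _ _).le

variable [CharZero L]

theorem classPart_sum_sub_classPart_sum {N : ℕ} (hN : N ≠ 0) {ζ : L} (hζ : IsPrimitiveRoot ζ N)
    {A B : Multiset L} (hA : ∀ x ∈ A, x ^ N = 1) (hB : ∀ x ∈ B, x ^ N = 1) (h : A.sum = B.sum)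
    {p : ℕ} (hp : p.Prime) (hpN : p ∣ N) {ω : L} (hω : ω ^ p = 1) (u : L) :
    (classPart N p A (u * ω)).sum - (classPart N p B (u * ω)).sum
      = ω * ((classPart N p A u).sum - (classPart N p B u).sum) := by
  classical
  let s : Finset L := (A + B).toFinset
  let c : L → ℚ := fun x => (A.count x : ℚ) - B.count x
  have hs : ∀ x ∈ s, x ^ N = 1 := fun x hx => by
    rcases Multiset.mem_add.1 (Multiset.mem_toFinset.1 hx) with hx | hx
    exacts [hA x hx, hB x hx]
  have hsub : ∀ C : Multiset L, C ≤ A + B → ∀ P : L → Prop,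
      (C.filter P).sum = ∑ x ∈ s with P x, (C.count x : L) * x := by
    intro C hC P
    rw [Finset.sum_multiset_count_of_subset (C.filter P) (s.filter P)]
    · refine Finset.sum_congr rfl fun x hx => ?_
      rw [Multiset.count_filter_of_pos (Finset.mem_filter.1 hx).2, nsmul_eq_mul]
    · intro x hx
      rw [Multiset.mem_toFinset, Multiset.mem_filter] at hx
      exact Finset.mem_filter.2 ⟨Multiset.mem_toFinset.2 (Multiset.mem_of_le hC hx.1), hx.2⟩
  have hc : ∀ P : L → Prop, ∑ x ∈ s with P x, (c x : L) * x
      = (A.filter P).sum - (B.filter P).sum := by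
    intro P
    rw [hsub A (Multiset.le_add_right _ _), hsub B (Multiset.le_add_left _ _),
      ← Finset.sum_sub_distrib]
    refine Finset.sum_congr rfl fun x _ => ?_
    simp only [c]
    push_cast
    ring
  have h0 : ∑ x ∈ s, (c x : L) * x = 0 := by
    have := hc fun _ => True
    simpa [h, Multiset.filter_eq_self.2] using this
  have := sum_filter_primaryPart_mul hN hζ s hs c h0 hp hpN hω u
  rw [hc, hc] at this
  exact this

theorem classPart_sum_mul_of_sum_eq_zero {N : ℕ} (hN : N ≠ 0) {ζ : L} (hζ : IsPrimitiveRoot ζ N)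
    {V : Multiset L} (hV : ∀ x ∈ V, x ^ N = 1) (h : V.sum = 0)
    {p : ℕ} (hp : p.Prime) (hpN : p ∣ N) {ω : L} (hω : ω ^ p = 1) (u : L) :
    (classPart N p V (u * ω)).sum = ω * (classPart N p V u).sum := by
  have := classPart_sum_sub_classPart_sum hN hζ hV (B := 0) (by simp) (by simpa using h)
    hp hpN hω u
  simpa [classPart] using this

theorem exists_le_primaryPart_const {N : ℕ} (hN : N ≠ 0) {ζ : L} (hζ : IsPrimitiveRoot ζ N)
    {V : Multiset L} (hV : ∀ x ∈ V, x ^ N = 1) (hV0 : V ≠ 0) (hsum : V.sum = 0)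
    (Q : Finset ℕ) (hQ : ∀ q ∈ Q, q.Prime ∧ q ∣ N ∧ ¬ CoversCoset N q V) :
    ∃ W ≤ V, W ≠ 0 ∧ W.sum = 0 ∧ ∀ q ∈ Q, ∃ u, ∀ x ∈ W, primaryPart N q x = u := by
  classical
  induction Q using Finset.induction_on with
  | empty => exact ⟨V, le_rfl, hV0, hsum, by simp⟩
  | insert p Q _ ih =>
    obtain ⟨W, hWV, hW0, hWsum, hW⟩ := ih fun q hq => hQ q (Finset.mem_insert_of_mem hq)
    obtain ⟨hp, hpN, hcov⟩ := hQ p (Finset.mem_insert_self _ _)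
    obtain ⟨x, hx⟩ := Multiset.exists_mem_of_ne_zero hW0
    have hcov' : ¬ ∀ ω : L, ω ^ p = 1 → ∃ y ∈ W, primaryPart N p y = primaryPart N p x * ω :=
      fun h => hcov (CoversCoset.mono ⟨_, h⟩ hWV)
    push Not at hcov'
    obtain ⟨ω, hω, hωW⟩ := hcov'
    have h1 := classPart_sum_mul_of_sum_eq_zero hN hζ
      (fun y hy => hV y (Multiset.mem_of_le hWV hy)) hWsum hp hpN hω (primaryPart N p x)
    have h2 : classPart N p W (primaryPart N p x * ω) = 0 :=
      Multiset.eq_zero_of_forall_notMem fun y hy =>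
        hωW y (mem_classPart.1 hy).1 (mem_classPart.1 hy).2
    rw [h2, Multiset.sum_zero, eq_comm, mul_eq_zero,
      or_iff_right (ne_zero_of_pow_eq_one hp.ne_zero hω)] at h1
    refine ⟨classPart N p W (primaryPart N p x), (classPart_le _ _ _ _).trans hWV, ?_, h1, ?_⟩
    · intro h0
      have : x ∈ classPart N p W (primaryPart N p x) := mem_classPart.2 ⟨hx, rfl⟩
      rw [h0] at this
      exact Multiset.notMem_zero _ this
    · intro q hq
      rcases Finset.mem_insert.1 hq with rfl | hq
      · exact ⟨_, fun y hy => (mem_classPart.1 hy).2⟩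
      · obtain ⟨u, hu⟩ := hW q hq
        exact ⟨u, fun y hy => hu y (mem_classPart.1 hy).1⟩

/-- If `A` and `B` have equal sums, consist of elements with the same `q`-primary parts for all
odd `q`, and `A` contains `x` but not `-x`, then `x` belongs to `B`. -/
theorem mem_of_sum_eq_of_odd_primaryPart_eq {N : ℕ} (hN : N ≠ 0) (hN2 : 2 ∣ N) {ζ : L}
    (hζ : IsPrimitiveRoot ζ N) {A B : Multiset L} (hA : ∀ x ∈ A, x ^ N = 1)
    (hB : ∀ x ∈ B, x ^ N = 1) (h : A.sum = B.sum) {x : L} (hx : x ∈ A) (hnx : -x ∉ A)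
    (hq : ∀ y ∈ A + B, ∀ q : ℕ, q.Prime → q ∣ N → q ≠ 2 →
      primaryPart N q y = primaryPart N q x) : x ∈ B := by
  classical
  by_contra hxB
  have hxN := hA x hx
  have hnxN : (-x) ^ N = 1 := by
    rw [neg_pow, hxN, mul_one, (even_iff_two_dvd.2 hN2).neg_one_pow]
  have hAB : ∀ y ∈ A + B, y ^ N = 1 := fun y hy => by
    rcases Multiset.mem_add.1 hy with hy | hy
    exacts [hA y hy, hB y hy]
  have e1 : ∀ y ∈ A + B, primaryPart N 2 y = primaryPart N 2 x → y = x := by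
    intro y hy h2
    refine eq_of_primaryPart_eq hN (hAB y hy) hxN fun q hqp hqN => ?_
    rcases eq_or_ne q 2 with rfl | hq2
    exacts [h2, hq y hy q hqp hqN hq2]
  have e2 : ∀ y ∈ A + B, primaryPart N 2 y = primaryPart N 2 x * -1 → y = -x := by
    intro y hy h2
    refine eq_of_primaryPart_eq hN (hAB y hy) hnxN fun q hqp hqN => ?_
    rcases eq_or_ne q 2 with rfl | hq2
    · rw [primaryPart_two_neg hN hN2, h2, mul_neg_one]
    · rw [primaryPart_neg_of_ne_two hN2 hqp hq2, hq y hy q hqp hqN hq2]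
  have key := classPart_sum_sub_classPart_sum hN hζ hA hB h Nat.prime_two hN2
    (ω := -1) (by norm_num) (primaryPart N 2 x)
  have c1 : classPart N 2 A (primaryPart N 2 x * -1) = 0 :=
    Multiset.eq_zero_of_forall_notMem fun y hy => by
      obtain ⟨hyA, hy2⟩ := mem_classPart.1 hy
      exact hnx (e2 y (Multiset.mem_add.2 (Or.inl hyA)) hy2 ▸ hyA)
  have c2 : classPart N 2 B (primaryPart N 2 x) = 0 :=
    Multiset.eq_zero_of_forall_notMem fun y hy => by
      obtain ⟨hyB, hy2⟩ := mem_classPart.1 hy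
      exact hxB (e1 y (Multiset.mem_add.2 (Or.inr hyB)) hy2 ▸ hyB)
  have c3 : (classPart N 2 A (primaryPart N 2 x))
      = Multiset.replicate (classPart N 2 A (primaryPart N 2 x)).card x :=
    Multiset.eq_replicate_card.2 fun y hy =>
      e1 y (Multiset.mem_add.2 (Or.inl (mem_classPart.1 hy).1)) (mem_classPart.1 hy).2
  have c4 : (classPart N 2 B (primaryPart N 2 x * -1))
      = Multiset.replicate (classPart N 2 B (primaryPart N 2 x * -1)).card (-x) :=
    Multiset.eq_replicate_card.2 fun y hy =>
      e2 y (Multiset.mem_add.2 (Or.inr (mem_classPart.1 hy).1)) (mem_classPart.1 hy).2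
  have c5 : 0 < (classPart N 2 A (primaryPart N 2 x)).card :=
    Multiset.card_pos_iff_exists_mem.2 ⟨x, mem_classPart.2 ⟨hx, rfl⟩⟩
  rw [c1, c2, c3, c4, Multiset.sum_replicate, Multiset.sum_replicate, Multiset.sum_zero,
    nsmul_eq_mul, nsmul_eq_mul] at key
  have hx0 := ne_zero_of_pow_eq_one hN hxN
  have : (((classPart N 2 A (primaryPart N 2 x)).card
      + (classPart N 2 B (primaryPart N 2 x * -1)).card : ℕ) : L) * x = 0 := by
    push_cast
    linear_combination key
  rw [mul_eq_zero, or_iff_left hx0, Nat.cast_eq_zero] at this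
  omega

/-- A vanishing sum of `N`-th roots of unity covers a coset of the `p`-th roots of unity for some
prime `p ≥ 5`, or contains an antipodal pair, or contains a rotated copy of the cube roots
of unity. -/
theorem exists_le_of_sum_eq_zero {N : ℕ} (hN : N ≠ 0) (hN2 : 2 ∣ N) {ζ : L}
    (hζ : IsPrimitiveRoot ζ N) {V : Multiset L} (hV : ∀ x ∈ V, x ^ N = 1) (hV0 : V ≠ 0)
    (hsum : V.sum = 0) :
    (∃ p : ℕ, p.Prime ∧ 5 ≤ p ∧ p ∣ N ∧ CoversCoset N p V) ∨ (∃ x, {x, -x} ≤ V) ∨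
      ∃ x y z : L, {x, y, z} ≤ V ∧ x + y + z = 0 ∧ x ^ 3 = y ^ 3 ∧ y ^ 3 = z ^ 3 := by
  classical
  rw [or_iff_not_imp_left, or_iff_not_imp_left]
  intro hcov hpair
  push Not at hcov
  obtain ⟨W, hWV, hW0, hWsum, hW⟩ := exists_le_primaryPart_const hN hζ hV hV0 hsum
    (N.primeFactors.filter (5 ≤ ·)) fun q hq => by
      simp only [Finset.mem_filter, Nat.mem_primeFactors] at hq
      exact ⟨hq.1.1, hq.1.2.1, hcov q hq.1.1 hq.2 hq.1.2.1⟩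
  have hWN : ∀ x ∈ W, x ^ N = 1 := fun x hx => hV x (Multiset.mem_of_le hWV hx)
  have hneg : ∀ x ∈ W, -x ∉ W := by
    intro x hx hnx
    have hx0 := ne_zero_of_pow_eq_one hN (hWN x hx)
    refine hpair ⟨x, le_trans ?_ hWV⟩
    rw [Multiset.insert_eq_cons, Multiset.le_iff_subset (by simpa using self_ne_neg.2 hx0)]
    intro y hy
    simp only [Multiset.mem_cons, Multiset.mem_singleton] at hy
    rcases hy with rfl | rfl <;> assumption
  have hW5 : ∀ x ∈ W, ∀ y ∈ W, ∀ q : ℕ, q.Prime → q ∣ N → 5 ≤ q →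
      primaryPart N q x = primaryPart N q y := by
    intro x hx y hy q hq hqN hq5
    obtain ⟨u, hu⟩ := hW q (by simp [hq, hqN, hq5, hN])
    rw [hu x hx, hu y hy]
  obtain ⟨x, hx⟩ := Multiset.exists_mem_of_ne_zero hW0
  have hprime : ∀ q : ℕ, q.Prime → q ≠ 2 → q ≠ 3 → 5 ≤ q := by
    intro q hq h2 h3
    have := hq.two_le
    have h4 : q ≠ 4 := by rintro rfl; revert hq; decide
    omega
  by_cases h3 : 3 ∣ N
  swap
  · have := mem_of_sum_eq_of_odd_primaryPart_eq hN hN2 hζ hWN (B := 0) (by simp)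
      (by simpa using hWsum) hx (hneg x hx) (fun y hy q hq hqN hq2 => by
        rw [add_zero] at hy
        refine hW5 y hy x hx q hq hqN (hprime q hq hq2 ?_)
        rintro rfl
        exact h3 hqN)
    exact absurd this (Multiset.notMem_zero _)
  obtain ⟨d, hd⟩ := h3
  have hω : IsPrimitiveRoot (ζ ^ d) 3 := hζ.pow (Nat.pos_of_ne_zero hN) (by rw [hd, mul_comm])
  have hrot : ∀ ω : L, ω ^ 3 = 1 → x * ω ∈ W := by
    intro ω hω
    have hω0 := ne_zero_of_pow_eq_one three_ne_zero hω
    have hωN : ω ^ N = 1 := by rw [hd, pow_mul, hω, one_pow]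
    have h3N : 3 ∣ N := ⟨d, hd⟩
    set u := primaryPart N 3 x with hu
    have key := classPart_sum_mul_of_sum_eq_zero hN hζ hWN hWsum Nat.prime_three h3N hω u
    have h1 : x ∈ (classPart N 3 W (u * ω)).map (· * ω⁻¹) := by
      refine mem_of_sum_eq_of_odd_primaryPart_eq (A := classPart N 3 W u) hN hN2 hζ ?_ ?_ ?_
        (mem_classPart.2 ⟨hx, rfl⟩) ?_ ?_
      · intro y hy
        exact hWN y (mem_classPart.1 hy).1
      · intro y hy
        obtain ⟨z, hz, rfl⟩ := Multiset.mem_map.1 hy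
        rw [mul_pow, hWN z (mem_classPart.1 hz).1, inv_pow, hωN, inv_one, one_mul]
      · rw [Multiset.sum_map_mul_right, Multiset.map_id', key]
        field_simp
      · exact fun h => hneg x hx (mem_classPart.1 h).1
      · intro y hy q hq hqN hq2
        rcases Multiset.mem_add.1 hy with hy | hy
        · obtain ⟨hyW, hy3⟩ := mem_classPart.1 hy
          by_cases hq3 : q = 3
          · rw [hq3, hy3]
          · exact hW5 y hyW x hx q hq hqN (hprime q hq hq2 hq3)
        · obtain ⟨z, hz, rfl⟩ := Multiset.mem_map.1 hy
          obtain ⟨hzW, hz3⟩ := mem_classPart.1 hz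
          have hω' : (ω⁻¹) ^ 3 = 1 := by rw [inv_pow, hω, inv_one]
          by_cases hq3 : q = 3
          · rw [hq3, primaryPart_mul, hz3, primaryPart_self hN Nat.prime_three h3N hω',
              mul_inv_cancel_right₀ hω0]
          · rw [primaryPart_mul, primaryPart_of_ne Nat.prime_three hq (Ne.symm hq3) h3N hω',
              mul_one]
            exact hW5 z hzW x hx q hq hqN (hprime q hq hq2 hq3)
    obtain ⟨z, hz, hzx⟩ := Multiset.mem_map.1 h1
    rw [← hzx, inv_mul_cancel_right₀ hω0]
    exact (mem_classPart.1 hz).1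
  have hx0 := ne_zero_of_pow_eq_one hN (hWN x hx)
  set ω := ζ ^ d
  have hω3 : ω ^ 3 = 1 := hω.pow_eq_one
  have hω1 : ω ≠ 1 := hω.ne_one (by norm_num)
  have hω2 : ω ^ 2 ≠ 1 := hω.pow_ne_one_of_pos_of_lt (by norm_num) (by norm_num)
  have hω0 := ne_zero_of_pow_eq_one three_ne_zero hω3
  have hgeom : ω ^ 2 + ω + 1 = 0 := by
    apply mul_left_cancel₀ (sub_ne_zero.2 hω1)
    linear_combination hω3
  refine ⟨x, x * ω, x * ω ^ 2, le_trans ?_ hWV, by linear_combination x * hgeom, ?_, ?_⟩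
  · rw [Multiset.insert_eq_cons, Multiset.insert_eq_cons, Multiset.le_iff_subset]
    · intro y hy
      simp only [Multiset.mem_cons, Multiset.mem_singleton] at hy
      rcases hy with rfl | rfl | rfl
      exacts [hx, hrot ω hω3, hrot (ω ^ 2) (by rw [← pow_mul, mul_comm, pow_mul, hω3, one_pow])]
    · have n1 : x ≠ x * ω := fun h => hω1 (mul_left_cancel₀ hx0 (by rw [← h, mul_one]))
      have n2 : x ≠ x * ω ^ 2 := fun h => hω2 (mul_left_cancel₀ hx0 (by rw [← h, mul_one]))
      have n3 : x * ω ≠ x * ω ^ 2 := fun h => hω1 (by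
        have := mul_left_cancel₀ hx0 h
        apply mul_left_cancel₀ hω0
        rw [mul_one, ← sq, ← this])
      simp [n1, n2, n3]
  · rw [mul_pow, hω3, mul_one]
  · rw [mul_pow, mul_pow, hω3, ← pow_mul, mul_comm 2 3, pow_mul, hω3, one_pow]

/-- Three `N`-th roots of unity with sum zero have the same cube. -/
theorem cube_eq_of_add_add_eq_zero {N : ℕ} (hN : N ≠ 0) (hN2 : 2 ∣ N) {ζ : L}
    (hζ : IsPrimitiveRoot ζ N) {x y z : L} (hx : x ^ N = 1) (hy : y ^ N = 1) (hz : z ^ N = 1)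
    (h : x + y + z = 0) : x ^ 3 = y ^ 3 ∧ y ^ 3 = z ^ 3 := by
  have hV : ∀ w ∈ ({x, y, z} : Multiset L), w ^ N = 1 := by
    simp [hx, hy, hz]
  have hsum : ({x, y, z} : Multiset L).sum = 0 := by
    simpa [← add_assoc] using h
  rcases exists_le_of_sum_eq_zero hN hN2 hζ hV (by simp) hsum with
    ⟨p, hp, hp5, hpN, hcov⟩ | ⟨w, hw⟩ | ⟨a, b, c, habc, -, hab, hbc⟩
  · have := hcov.le_card hN hp hpN hζ hV
    simp at this
    omega
  · obtain ⟨U, hU⟩ := Multiset.le_iff_exists_add.1 hw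
    have hcard : U.card = 1 := by
      have := congrArg Multiset.card hU
      simp at this
      omega
    obtain ⟨t, rfl⟩ := Multiset.card_eq_one.1 hcard
    have ht : t = 0 := by
      rw [hU] at hsum
      simpa using hsum
    have := hV t (by rw [hU]; simp)
    exact absurd ht (ne_zero_of_pow_eq_one hN this)
  · have heq := Multiset.eq_of_le_of_card_le habc (by simp)
    have hcube : ∀ w ∈ ({x, y, z} : Multiset L), w ^ 3 = a ^ 3 := by
      rw [← heq]
      simp [hab, hbc]
    simp only [Multiset.insert_eq_cons, Multiset.mem_cons, Multiset.mem_singleton] at hcube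
    rw [hcube x (by simp), hcube y (by simp), hcube z (by simp)]
    exact ⟨rfl, rfl⟩

end VanishingSums

section MinimalRep

variable {L : Type*} [Field L]

/-- A multiset of `N`-th roots of unity which has the least cardinality among all those with the
same sum. -/
structure IsMinimalRep (N : ℕ) (A : Multiset L) : Prop where
  pow_eq_one : ∀ x ∈ A, x ^ N = 1
  card_le : ∀ B : Multiset L, (∀ x ∈ B, x ^ N = 1) → B.sum = A.sum → A.card ≤ B.card

theorem exists_isMinimalRep {N : ℕ} {A : Multiset L} (hA : ∀ x ∈ A, x ^ N = 1) :
    ∃ B : Multiset L, IsMinimalRep N B ∧ B.sum = A.sum ∧ B.card ≤ A.card := by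
  classical
  have h : ∃ n, ∃ B : Multiset L, (∀ x ∈ B, x ^ N = 1) ∧ B.sum = A.sum ∧ B.card = n :=
    ⟨_, A, hA, rfl, rfl⟩
  obtain ⟨B, hB, hBA, hn⟩ := Nat.find_spec h
  have key : ∀ C : Multiset L, (∀ x ∈ C, x ^ N = 1) → C.sum = A.sum → B.card ≤ C.card :=
    fun C hC hCA => hn.trans_le (Nat.find_min' h ⟨C, hC, hCA, rfl⟩)
  exact ⟨B, ⟨hB, fun C hC hCB => key C hC (hCB.trans hBA)⟩, hBA, key A hA rfl⟩

namespace IsMinimalRep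

variable {N : ℕ} {A B : Multiset L}

theorem of_le (hA : IsMinimalRep N A) (hBA : B ≤ A) : IsMinimalRep N B := by
  obtain ⟨D, rfl⟩ := Multiset.le_iff_exists_add.1 hBA
  refine ⟨fun x hx => hA.pow_eq_one x (Multiset.mem_of_le hBA hx), fun C hC hCB => ?_⟩
  have := hA.card_le (C + D) (fun x hx => ?_) (by simp [hCB])
  · simpa using this
  · rcases Multiset.mem_add.1 hx with hx | hx
    · exact hC x hx
    · exact hA.pow_eq_one x (Multiset.mem_add.2 (Or.inr hx))

theorem sum_ne_zero (hA : IsMinimalRep N A) (h0 : A ≠ 0) : A.sum ≠ 0 := fun h => by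
  have := hA.card_le 0 (by simp) (by simp [h])
  simp [h0] at this

theorem congr_sum (hA : IsMinimalRep N A) (hB : ∀ x ∈ B, x ^ N = 1) (hs : B.sum = A.sum)
    (hc : B.card ≤ A.card) : IsMinimalRep N B :=
  ⟨hB, fun C hC hCB => hc.trans (hA.card_le C hC (hCB.trans hs))⟩

/-- A minimal representation with more than one element does not sum to a root of unity. -/
theorem sum_pow_ne_one (hA : IsMinimalRep N A) (hc : 2 ≤ A.card) : A.sum ^ N ≠ 1 := fun h => by
  have := hA.card_le {A.sum} (by simpa using h) (by simp)
  simp at this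
  omega

theorem map (hA : IsMinimalRep N A) {F : Type*} [EquivLike F L L] [RingEquivClass F L L] (σ : F)
    (hσ : σ A.sum = A.sum) : IsMinimalRep N (A.map σ) := by
  refine hA.congr_sum (fun x hx => ?_) ?_ (by simp)
  · obtain ⟨y, hy, rfl⟩ := Multiset.mem_map.1 hx
    rw [← map_pow, hA.pow_eq_one y hy, map_one]
  · rw [← map_multiset_sum, hσ]

/-- Distinct minimal representations of the same element jointly cover a coset of the `p`-th roots
of unity for some prime `p ≥ 5`. -/
theorem exists_coversCoset [CharZero L] (hA : IsMinimalRep N A) (hB : IsMinimalRep N B)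
    (hN : N ≠ 0) (hN2 : 2 ∣ N) {ζ : L} (hζ : IsPrimitiveRoot ζ N)
    (hsum : A.sum = B.sum) (hne : A ≠ B) :
    ∃ p : ℕ, p.Prime ∧ 5 ≤ p ∧ p ∣ N ∧ CoversCoset N p (A + B) := by
  classical
  have hneg : ∀ x : L, x ^ N = 1 → (-x) ^ N = 1 := fun x hx => by
    rw [neg_pow, hx, mul_one, (even_iff_two_dvd.2 hN2).neg_one_pow]
  have hdisj : ∀ x, x ∈ A - B → x ∉ B - A := by
    intro x h1 h2
    rw [← Multiset.count_pos, Multiset.count_sub] at h1 h2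
    omega
  have hiA : A - B + A ∩ B = A := Multiset.sub_add_inter A B
  have hiB : B - A + A ∩ B = B := by rw [Multiset.inter_comm]; exact Multiset.sub_add_inter B A
  have hs' : (A - B).sum = (B - A).sum := by
    have h1 := congrArg Multiset.sum hiA
    have h2 := congrArg Multiset.sum hiB
    rw [Multiset.sum_add] at h1 h2
    linear_combination h1 - h2 + hsum
  have hA' : IsMinimalRep N (A - B) := hA.of_le tsub_le_self
  have hB' : IsMinimalRep N (B - A) := hB.of_le tsub_le_self
  set V : Multiset L := (A - B) + (B - A).map (- ·) with hVdef
  have hV : ∀ x ∈ V, x ^ N = 1 := by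
    intro x hx
    rcases Multiset.mem_add.1 hx with hx | hx
    · exact hA'.pow_eq_one x hx
    · obtain ⟨y, hy, rfl⟩ := Multiset.mem_map.1 hx
      exact hneg y (hB'.pow_eq_one y hy)
  have hVsum : V.sum = 0 := by
    rw [hVdef, Multiset.sum_add, Multiset.sum_map_neg, Multiset.map_id', hs', add_neg_cancel]
  have hV0 : V ≠ 0 := by
    intro h
    rw [hVdef, add_eq_zero, Multiset.map_eq_zero] at h
    exact hne (hiA.symm.trans ((by rw [h.1, h.2] : _ = B - A + A ∩ B).trans hiB))
  -- a vanishing part of `V` splits evenly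
  have hsplit : ∀ W ≤ V, W.sum = 0 → ∃ S ≤ A - B, ∃ T ≤ B - A,
      W = S + T.map (- ·) ∧ S.card = T.card := by
    intro W hW hW0
    obtain ⟨S, hS, T', hT', rfl⟩ : ∃ S ≤ A - B, ∃ T' ≤ (B - A).map (- ·), W = S + T' :=
      ⟨W ∩ (A - B), Multiset.inter_le_right, W - (A - B), tsub_le_iff_left.2 hW,
        by rw [add_comm, Multiset.sub_add_inter]⟩
    have hT : T'.map (- ·) ≤ B - A := by
      have := Multiset.map_le_map (f := (- · : L → L)) hT'
      simpa [Multiset.map_map] using this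
    refine ⟨S, hS, T'.map (- ·), hT, by simp [Multiset.map_map], ?_⟩
    have hst : S.sum = (T'.map (- ·)).sum := by
      rw [Multiset.sum_map_neg, Multiset.map_id']
      rw [Multiset.sum_add] at hW0
      linear_combination hW0
    have h1 := hA'.of_le hS
    have h2 := hB'.of_le hT
    exact le_antisymm (h1.card_le _ h2.pow_eq_one hst.symm) (h2.card_le _ h1.pow_eq_one hst)
  rcases exists_le_of_sum_eq_zero hN hN2 hζ hV hV0 hVsum with
    ⟨p, hp, hp5, hpN, u, hu⟩ | ⟨x, hx⟩ | ⟨x, y, z, hxyz, h0, -⟩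
  · refine ⟨p, hp, hp5, hpN, u, fun ω hω => ?_⟩
    obtain ⟨x, hx, hxu⟩ := hu ω hω
    rcases Multiset.mem_add.1 hx with hx | hx
    · exact ⟨x, Multiset.mem_add.2 (Or.inl (Multiset.mem_of_le tsub_le_self hx)), hxu⟩
    · obtain ⟨y, hy, rfl⟩ := Multiset.mem_map.1 hx
      rw [primaryPart_neg_of_ne_two hN2 hp (by omega)] at hxu
      exact ⟨y, Multiset.mem_add.2 (Or.inr (Multiset.mem_of_le tsub_le_self hy)), hxu⟩
  · obtain ⟨S, hS, T, hT, hW, hc⟩ := hsplit _ hx (by simp)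
    have hc2 := congrArg Multiset.card hW
    simp only [Multiset.insert_eq_cons, Multiset.card_cons, Multiset.card_singleton,
      Multiset.card_add, Multiset.card_map] at hc2
    obtain ⟨s, rfl⟩ := Multiset.card_eq_one.1 (show S.card = 1 by omega)
    obtain ⟨t, rfl⟩ := Multiset.card_eq_one.1 (show T.card = 1 by omega)
    have hst : s = t := by
      have := congrArg Multiset.sum hW
      simp at this
      linear_combination -this
    subst hst
    exact absurd (Multiset.singleton_le.1 hT) (hdisj s (Multiset.singleton_le.1 hS))
  · obtain ⟨S, hS, T, hT, hW, hc⟩ := hsplit _ hxyz (by simpa [← add_assoc] using h0)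
    have hc2 := congrArg Multiset.card hW
    simp only [Multiset.insert_eq_cons, Multiset.card_cons, Multiset.card_singleton,
      Multiset.card_add, Multiset.card_map] at hc2
    omega

end IsMinimalRep

end MinimalRep

section CommutativeAction

/-- A finite commutative group acting faithfully on at most four points has at most as many
elements as there are points, or is trivial. -/
theorem card_le_of_faithful_of_commute {α : Type*} {G : Type*} [Group G] [Finite G]
    [MulAction G α] (hcomm : ∀ g h : G, g * h = h * g) (s : Finset α)
    (hs : ∀ g : G, ∀ x ∈ s, g • x ∈ s) (hfaith : ∀ g : G, (∀ x ∈ s, g • x = x) → g = 1)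
    (hcard : s.card ≤ 4) : Nat.card G ≤ max 1 s.card := by
  classical
  induction hn : s.card using Nat.strong_induction_on generalizing s G with
  | _ n ih =>
  rcases s.eq_empty_or_nonempty with rfl | ⟨x, hx⟩
  · have : Subsingleton G := ⟨fun g h => by rw [hfaith g (by simp), hfaith h (by simp)]⟩
    exact (Finite.card_le_one_iff_subsingleton.2 this).trans (le_max_left _ _)
  · have hfin : (MulAction.orbit G x).Finite := Set.finite_range _
    set O : Finset α := hfin.toFinset with hO
    have hOs : O ⊆ s := by
      intro y hy
      obtain ⟨g, rfl⟩ := hfin.mem_toFinset.1 hy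
      exact hs g x hx
    have hxO : x ∈ O := hfin.mem_toFinset.2 (MulAction.mem_orbit_self x)
    have hidx : O.card * Nat.card (MulAction.stabilizer G x) = Nat.card G := by
      rw [← Subgroup.index_mul_card (MulAction.stabilizer G x), MulAction.index_stabilizer, hO,
        Set.ncard_eq_toFinset_card _ hfin]
    have hsub : (s \ O).card = n - O.card := by rw [Finset.card_sdiff_of_subset hOs, hn]
    have hO1 : 1 ≤ O.card := Finset.card_pos.2 ⟨x, hxO⟩
    have hOn : O.card ≤ n := hn ▸ Finset.card_le_card hOs
    have hrec : Nat.card (MulAction.stabilizer G x) ≤ max 1 (n - O.card) := by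
      refine ih (n - O.card) (by omega) (fun g h => Subtype.ext (hcomm g h)) (s \ O) ?_ ?_
        (by omega) hsub
      · intro g y hy
        rw [Finset.mem_sdiff] at hy ⊢
        refine ⟨hs g y hy.1, fun h => hy.2 ?_⟩
        rw [hfin.mem_toFinset] at h ⊢
        obtain ⟨h', hh⟩ := h
        exact ⟨(g : G)⁻¹ * h', by
          change ((g : G)⁻¹ * h') • x = y
          rw [← smul_smul, inv_smul_eq_iff]
          exact hh⟩
      · intro g hg
        refine Subtype.ext (hfaith g fun y hy => ?_)
        by_cases hyO : y ∈ O
        · obtain ⟨h, rfl⟩ := hfin.mem_toFinset.1 hyO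
          change (g : G) • h • x = h • x
          rw [smul_smul, hcomm, ← smul_smul, g.2]
        · exact hg y (Finset.mem_sdiff.2 ⟨hy, hyO⟩)
    rw [← hidx]
    refine (Nat.mul_le_mul_left _ hrec).trans ?_
    have hn4 : n ≤ 4 := hn ▸ hcard
    generalize O.card = a at *
    interval_cases n <;> interval_cases a <;> simp

end CommutativeAction

section Classes

variable {L : Type*} [Field L] {N p : ℕ} {A : Multiset L} {u : L}

theorem sum_classPart [DecidableEq L] (I : Finset L) :
    ∑ v ∈ I, classPart N p A v = A.filter (primaryPart N p · ∈ I) := by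
  induction I using Finset.induction_on with
  | empty => simp
  | insert v I hv ih =>
    have := Multiset.filter_add_filter (primaryPart N p · = v) (primaryPart N p · ∈ I) A
    rw [(Multiset.filter_eq_nil (p := fun a => primaryPart N p a = v ∧ _)).2
      fun a _ h => hv (h.1 ▸ h.2), add_zero] at this
    rw [Finset.sum_insert hv, ih]
    convert this using 2
    · rw [classPart]
      congr!
    · simp

theorem sum_classPart_le (I : Finset L) : ∑ v ∈ I, classPart N p A v ≤ A := by
  classical
  rw [sum_classPart]
  exact Multiset.filter_le _ _

theorem sum_classPart_mul_le (hu : u ≠ 0) (S : Finset L) :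
    ∑ ω ∈ S, classPart N p A (u * ω) ≤ A := by
  classical
  have := sum_classPart_le (N := N) (p := p) (A := A) (S.image (u * ·))
  rwa [Finset.sum_image fun x _ y _ h => mul_left_cancel₀ hu h] at this

theorem sum_classPart_mul_add_le (hu : u ≠ 0) {v : L} (hv : v ≠ 0) (S T : Finset L)
    (hd : ∀ ω ∈ S, ∀ θ ∈ T, u * ω ≠ v * θ) :
    ∑ ω ∈ S, classPart N p A (u * ω) + ∑ ω ∈ T, classPart N p A (v * ω) ≤ A := by
  classical
  have := sum_classPart_le (N := N) (p := p) (A := A) (S.image (u * ·) ∪ T.image (v * ·))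
  rwa [Finset.sum_union, Finset.sum_image fun x _ y _ h => mul_left_cancel₀ hu h,
    Finset.sum_image fun x _ y _ h => mul_left_cancel₀ hv h] at this
  rw [Finset.disjoint_left]
  intro w h1 h2
  obtain ⟨a, ha, rfl⟩ := Finset.mem_image.1 h1
  obtain ⟨b, hb, hab⟩ := Finset.mem_image.1 h2
  exact hd a ha b hb hab.symm

theorem classPart_map {E : Type*} [EquivLike E L L] [RingEquivClass E L L] (τ : E) (v : L) :
    classPart N p (A.map τ) (τ v) = (classPart N p A v).map τ := by
  classical
  rw [classPart, classPart, Multiset.filter_map]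
  congr 1
  refine Multiset.filter_congr fun x _ => ?_
  simp only [Function.comp, ← map_primaryPart]
  exact (EquivLike.injective τ).eq_iff

open Classical in
/-- The `p`-th roots of unity `ω` such that some element of `A` has `p`-primary part `u * ω`. -/
noncomputable def hitSet (N p : ℕ) (A : Multiset L) (u : L) : Finset L :=
  (Polynomial.nthRootsFinset p (1 : L)).filter fun ω => classPart N p A (u * ω) ≠ 0

theorem mem_hitSet (hp : p.Prime) {ω : L} :
    ω ∈ hitSet N p A u ↔ ω ^ p = 1 ∧ classPart N p A (u * ω) ≠ 0 := by
  classical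
  rw [hitSet, Finset.mem_filter, Polynomial.mem_nthRootsFinset hp.pos]

theorem card_hitSet_le_card_sum :
    (hitSet N p A u).card ≤ (∑ ω ∈ hitSet N p A u, classPart N p A (u * ω)).card := by
  classical
  rw [Multiset.card_sum, Finset.card_eq_sum_ones]
  exact Finset.sum_le_sum fun ω hω => Multiset.card_pos.2 (Finset.mem_filter.1 hω).2

theorem card_hitSet_le (hu : u ≠ 0) : (hitSet N p A u).card ≤ A.card :=
  card_hitSet_le_card_sum.trans (Multiset.card_le_card (sum_classPart_mul_le hu _))

theorem IsMinimalRep.mem_hitSet_iff (hA : IsMinimalRep N A) (hp : p.Prime) {ω : L}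
    (hω : ω ^ p = 1) : ω ∈ hitSet N p A u ↔ (classPart N p A (u * ω)).sum ≠ 0 := by
  rw [mem_hitSet hp, and_iff_right hω]
  refine ⟨fun h => (hA.of_le (classPart_le _ _ _ _)).sum_ne_zero h, fun h h0 => h (by simp [h0])⟩

theorem ne_zero_of_hitSet_nonempty (hN : N ≠ 0) (hA : ∀ x ∈ A, x ^ N = 1) (hp : p.Prime)
    (h : (hitSet N p A u).Nonempty) : u ≠ 0 := by
  obtain ⟨ω, hω⟩ := h
  obtain ⟨x, hx⟩ := Multiset.exists_mem_of_ne_zero ((mem_hitSet hp).1 hω).2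
  obtain ⟨hxA, hxu⟩ := mem_classPart.1 hx
  rintro rfl
  rw [zero_mul] at hxu
  exact pow_ne_zero _ (ne_zero_of_pow_eq_one hN (hA x hxA)) hxu

end Classes

section Fixed

variable {L : Type*} [Field L] {N p : ℕ} {A : Multiset L} {u : L}

/-- A set of `p`-th roots of unity stable under multiplication by a nontrivial one has at least
`p` elements. -/
theorem le_card_of_mul_mem (hp : p.Prime) {X : Finset L} {ω θ : L} (hω : ω ∈ X) (hω0 : ω ≠ 0)
    (hθ : θ ^ p = 1) (hθ1 : θ ≠ 1) (h : ∀ x ∈ X, x * θ ∈ X) : p ≤ X.card := by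
  classical
  have hθp : IsPrimitiveRoot θ p := by
    have := IsPrimitiveRoot.orderOf θ
    rwa [orderOf_eq_prime_iff (hp := ⟨hp⟩) |>.2 ⟨hθ, hθ1⟩] at this
  have hmem : ∀ i : ℕ, ω * θ ^ i ∈ X := by
    intro i
    induction i with
    | zero => simpa using hω
    | succ i ih => rw [pow_succ, ← mul_assoc]; exact h _ ih
  calc p = ((Finset.range p).image fun i => ω * θ ^ i).card := by
        rw [Finset.card_image_of_injOn, Finset.card_range]
        intro i hi j hj hij
        exact hθp.pow_inj (Finset.mem_range.1 hi) (Finset.mem_range.1 hj)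
          (mul_left_cancel₀ hω0 hij)
    _ ≤ X.card := Finset.card_le_card fun x hx => by
        obtain ⟨i, -, rfl⟩ := Finset.mem_image.1 hx
        exact hmem i

/-- A minimal representation cannot have more than half of the classes in a coset of the `p`-th
roots of unity, all of them with proportional sums, one of which is a root of unity. -/
theorem IsMinimalRep.not_forall_sum_eq (hA : IsMinimalRep N A) (hp : p.Prime) (hN : N ≠ 0)
    (hN2 : 2 ∣ N) (hpN : p ∣ N) {ζ : L} (hζ : IsPrimitiveRoot ζ N) (hu : u ≠ 0) {γ : L}
    (hγ : γ ^ N = 1) (hX : p < 2 * (hitSet N p A u).card)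
    (h : ∀ ω ∈ hitSet N p A u, (classPart N p A (u * ω)).sum = ω * γ) : False := by
  classical
  have : NeZero p := ⟨hp.ne_zero⟩
  obtain ⟨d, hd⟩ := id hpN
  have hω : IsPrimitiveRoot (ζ ^ d) p := hζ.pow (Nat.pos_of_ne_zero hN) (by rw [hd, mul_comm])
  set M := Polynomial.nthRootsFinset p (1 : L) with hM
  set X := hitSet N p A u with hXdef
  have hXM : X ⊆ M := Finset.filter_subset _ _
  have hsum0 : ∑ ω ∈ M, ω = 0 := by
    rw [← hω.geom_sum_eq_zero hp.one_lt]
    symm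
    refine Finset.sum_bij (fun i _ => (ζ ^ d) ^ i) ?_ ?_ ?_ (by simp)
    · intro i _
      rw [hM, Polynomial.mem_nthRootsFinset hp.pos, ← pow_mul, mul_comm, pow_mul, hω.pow_eq_one,
        one_pow]
    · intro i hi j hj hij
      exact hω.pow_inj (Finset.mem_range.1 hi) (Finset.mem_range.1 hj) hij
    · intro ω hωM
      obtain ⟨i, hi, hi'⟩ := hω.eq_pow_of_pow_eq_one
        ((Polynomial.mem_nthRootsFinset hp.pos _).1 hωM)
      exact ⟨i, Finset.mem_range.2 hi, hi'⟩
  have hmin := hA.of_le (sum_classPart_mul_le (N := N) (p := p) hu X)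
  have hle := hmin.card_le ((M \ X).val.map fun ω => -(ω * γ)) ?_ ?_
  · have h1 := card_hitSet_le_card_sum (N := N) (p := p) (A := A) (u := u)
    rw [Multiset.card_map, Finset.card_val, Finset.card_sdiff_of_subset hXM, hM,
      hω.card_nthRootsFinset] at hle
    rw [← hXdef] at h1
    omega
  · intro x hx
    obtain ⟨ω, hω, rfl⟩ := Multiset.mem_map.1 hx
    have hωp := (Polynomial.mem_nthRootsFinset hp.pos (1 : L)).1 (Finset.mem_sdiff.1 hω).1
    rw [(even_iff_two_dvd.2 hN2).neg_pow, mul_pow, hγ, hd, pow_mul, hωp, one_pow, one_mul]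
  · change ∑ ω ∈ M \ X, -(ω * γ) = _
    have h2 : (∑ ω ∈ X, classPart N p A (u * ω)).sum = ∑ ω ∈ X, ω * γ := by
      rw [Multiset.sum_sum]
      exact Finset.sum_congr rfl h
    rw [h2, Finset.sum_neg_distrib, ← Finset.sum_mul, ← Finset.sum_mul]
    have := Finset.sum_sdiff (f := fun x : L => x) hXM
    rw [hsum0] at this
    linear_combination -γ * this

theorem hitSet_map (hp : p.Prime) {E : Type*} [EquivLike E L L] [RingEquivClass E L L] (τ : E)
    (v : L) : hitSet N p (A.map τ) (τ v) =
      (hitSet N p A v).map (EquivLike.toEquiv τ).toEmbedding := by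
  ext ω
  obtain ⟨ω, rfl⟩ := EquivLike.surjective τ ω
  have h1 : ∀ x : L, τ x ^ p = 1 ↔ x ^ p = 1 := fun x => by
    rw [← map_pow, map_eq_one_iff τ (EquivLike.injective τ)]
  rw [mem_hitSet hp, ← map_mul, classPart_map, h1, ne_eq, Multiset.map_eq_zero]
  simp only [Finset.mem_map, mem_hitSet hp, Equiv.coe_toEmbedding, EquivLike.coe_coe]
  constructor
  · exact fun h => ⟨ω, h, rfl⟩
  · rintro ⟨y, h, hy⟩
    rwa [← EquivLike.injective τ hy]

variable [CharZero L]

theorem IsMinimalRep.exists_map_eq_mul (hA : IsMinimalRep N A) (hA4 : A.card ≤ 4) (hN : N ≠ 0)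
    {ζ : L} (hζ : IsPrimitiveRoot ζ N) (hp : p.Prime) (hp5 : 5 ≤ p) (hpN : p ∣ N)
    (hX : p < 2 * (hitSet N p A u).card)
    {E : Type*} [EquivLike E L L] [RingEquivClass E L L] (τ : E) (hτ : τ A.sum = A.sum) :
    ∃ θ : L, θ ^ p = 1 ∧ τ u = u * θ := by
  classical
  by_contra hθ
  have hAN := hA.pow_eq_one
  have hu : u ≠ 0 := ne_zero_of_hitSet_nonempty hN hAN hp (Finset.card_pos.1 (by omega))
  obtain ⟨d, hd⟩ := id hpN
  have hpr : IsPrimitiveRoot (ζ ^ d) p := hζ.pow (Nat.pos_of_ne_zero hN) (by rw [hd, mul_comm])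
  have hne0 : ∀ {ω : L}, ω ^ p = 1 → ω ≠ 0 := ne_zero_of_pow_eq_one hp.ne_zero
  have hB := hA.map τ hτ
  obtain ⟨v, hv⟩ := EquivLike.surjective τ u
  have hv0 : v ≠ 0 := by
    rintro rfl
    exact hu (by rw [← hv, map_zero])
  have hYv := congrArg Finset.card (hitSet_map (N := N) (A := A) hp τ v)
  rw [hv, Finset.card_map] at hYv
  have hdis := Multiset.card_le_card (sum_classPart_mul_add_le (N := N) (p := p) (A := A) hu hv0
    (hitSet N p A u) (hitSet N p A v) (by
      intro ω hω θ hθ' h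
      have hωp := ((mem_hitSet hp).1 hω).1
      have hθp := ((mem_hitSet hp).1 hθ').1
      refine hθ ⟨τ (θ * ω⁻¹), by rw [← map_pow, mul_pow, inv_pow, hωp, hθp]; simp, ?_⟩
      rw [map_mul, ← mul_assoc]
      nth_rewrite 2 [← hv]
      rw [← map_mul, ← map_mul, ← h, mul_inv_cancel_right₀ (hne0 hωp)]))
  rw [Multiset.card_add] at hdis
  have h1 := card_hitSet_le_card_sum (N := N) (p := p) (A := A) (u := u)
  have h2 := card_hitSet_le_card_sum (N := N) (p := p) (A := A) (u := v)
  have h3 : (hitSet N p A u).card + (hitSet N p (A.map τ) u).card ≤ 4 := by omega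
  have hcov : ∀ ω : L, ω ^ p = 1 → ω ∈ hitSet N p A u ∪ hitSet N p (A.map τ) u := by
    by_contra! h
    obtain ⟨ω₀, hω₀, h⟩ := h
    rw [Finset.mem_union, hA.mem_hitSet_iff hp hω₀, hB.mem_hitSet_iff hp hω₀] at h
    push Not at h
    have hsum : A.sum = (A.map τ).sum := by rw [← map_multiset_sum, hτ]
    have key := fun {ω : L} (h : ω ^ p = 1) =>
      classPart_sum_sub_classPart_sum hN hζ hAN hB.pow_eq_one hsum hp hpN h u
    have h0 := key hω₀
    rw [h.1, h.2, sub_zero, eq_comm, mul_eq_zero, or_iff_right (hne0 hω₀)] at h0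
    have : hitSet N p A u ⊆ hitSet N p (A.map τ) u := by
      intro ω hω
      have hωp := ((mem_hitSet hp).1 hω).1
      have h4 := key hωp
      rw [h0, mul_zero, sub_eq_zero] at h4
      rwa [hB.mem_hitSet_iff hp hωp, ← h4, ← hA.mem_hitSet_iff hp hωp]
    have := Finset.card_le_card this
    omega
  have hle := Finset.card_le_card fun ω hω =>
    hcov ω ((Polynomial.mem_nthRootsFinset hp.pos (1 : L)).1 hω)
  rw [hpr.card_nthRootsFinset] at hle
  have := hle.trans (Finset.card_union_le _ _)
  omega

/-- If `A` has at most four elements and meets more than half of the classes in a coset of the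
`p`-th roots of unity, then an automorphism preserving `A.sum` and the `p`-th roots of unity
preserves the sums of `A` over these classes. -/
theorem IsMinimalRep.classPart_sum_fixed (hA : IsMinimalRep N A) (hA4 : A.card ≤ 4) (hN : N ≠ 0)
    (hN2 : 2 ∣ N) {ζ : L} (hζ : IsPrimitiveRoot ζ N) (hp : p.Prime) (hp5 : 5 ≤ p) (hpN : p ∣ N)
    (hX : p < 2 * (hitSet N p A u).card)
    {E : Type*} [EquivLike E L L] [RingEquivClass E L L] (τ : E) (hτ : τ A.sum = A.sum)
    (hτp : ∀ ω : L, ω ^ p = 1 → τ ω = ω) {ω : L} (hω : ω ^ p = 1) :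
    τ (classPart N p A (u * ω)).sum = (classPart N p A (u * ω)).sum := by
  classical
  have hinj : Function.Injective τ := EquivLike.injective τ
  have hAN := hA.pow_eq_one
  have hu : u ≠ 0 := ne_zero_of_hitSet_nonempty hN hAN hp (Finset.card_pos.1 (by omega))
  obtain ⟨d, hd⟩ := id hpN
  have hpr : IsPrimitiveRoot (ζ ^ d) p := hζ.pow (Nat.pos_of_ne_zero hN) (by rw [hd, mul_comm])
  have hM : (Polynomial.nthRootsFinset p (1 : L)).card = p := hpr.card_nthRootsFinset
  have hmemM : ∀ {ω : L}, ω ∈ Polynomial.nthRootsFinset p (1 : L) ↔ ω ^ p = 1 :=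
    Polynomial.mem_nthRootsFinset hp.pos _
  have hne0 : ∀ {ω : L}, ω ^ p = 1 → ω ≠ 0 := ne_zero_of_pow_eq_one hp.ne_zero
  have hB := hA.map τ hτ
  have hXA := card_hitSet_le (N := N) (p := p) (A := A) hu
  set B := A.map τ with hBdef
  set X := hitSet N p A u with hXdef
  set Y := hitSet N p B u with hYdef
  have hXiff : ∀ {ω : L}, ω ^ p = 1 → (ω ∈ X ↔ (classPart N p A (u * ω)).sum ≠ 0) :=
    hA.mem_hitSet_iff hp
  have hYiff : ∀ {ω : L}, ω ^ p = 1 → (ω ∈ Y ↔ (classPart N p B (u * ω)).sum ≠ 0) :=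
    hB.mem_hitSet_iff hp
  have hXp : ∀ {ω : L}, ω ∈ X → ω ^ p = 1 := fun h => ((mem_hitSet hp).1 h).1
  have hYp : ∀ {ω : L}, ω ∈ Y → ω ^ p = 1 := fun h => ((mem_hitSet hp).1 h).1
  set γ := (classPart N p A u).sum - (classPart N p B u).sum with hγ
  have key : ∀ {ω : L}, ω ^ p = 1 →
      (classPart N p A (u * ω)).sum - (classPart N p B (u * ω)).sum = ω * γ := fun h =>
    classPart_sum_sub_classPart_sum hN hζ hAN hB.pow_eq_one
      (by rw [hBdef, ← map_multiset_sum, hτ]) hp hpN h u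
  have hsubset : γ ≠ 0 → Polynomial.nthRootsFinset p (1 : L) ⊆ X ∪ Y := by
    intro hγ0 ω hω
    rw [hmemM] at hω
    rw [Finset.mem_union, hXiff hω, hYiff hω]
    by_contra! h
    have := key hω
    rw [h.1, h.2, sub_zero, eq_comm, mul_eq_zero] at this
    exact this.elim (hne0 hω) hγ0
  have hcover : γ ≠ 0 → p ≤ (X ∪ Y).card := fun h => by
    have := Finset.card_le_card (hsubset h)
    rwa [hM] at this
  have hXY : γ = 0 → X = Y := by
    intro hγ0
    ext ω
    by_cases hω : ω ^ p = 1
    · have := key hω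
      rw [hγ0, mul_zero, sub_eq_zero] at this
      rw [hXiff hω, hYiff hω, this]
    · exact ⟨fun h => absurd (hXp h) hω, fun h => absurd (hYp h) hω⟩
  obtain ⟨θ, hθp, hθ⟩ := hA.exists_map_eq_mul hA4 hN hζ hp hp5 hpN hX τ hτ
  have hθ0 := hne0 hθp
  have hmulp : ∀ {ω : L}, ω ^ p = 1 → (ω * θ) ^ p = 1 := fun h => by rw [mul_pow, h, hθp, one_mul]
  have hBτ : ∀ {ω : L}, ω ^ p = 1 →
      (classPart N p B (u * (ω * θ))).sum = τ (classPart N p A (u * ω)).sum := by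
    intro ω hω
    have : u * (ω * θ) = τ (u * ω) := by rw [map_mul, hθ, hτp ω hω]; ring
    rw [this, hBdef, classPart_map, ← map_multiset_sum]
  have hXYθ : ∀ {ω : L}, ω ^ p = 1 → (ω ∈ X ↔ ω * θ ∈ Y) := by
    intro ω hω
    rw [hXiff hω, hYiff (hmulp hω), hBτ hω, ne_eq, ne_eq, map_eq_zero_iff τ hinj]
  have hYX : Y = X.image (· * θ) := by
    ext ω
    rw [Finset.mem_image]
    constructor
    · intro h
      have hω := hYp h
      refine ⟨ω * θ⁻¹, (hXYθ ?_).2 ?_, inv_mul_cancel_right₀ hθ0 _⟩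
      · rw [mul_pow, inv_pow, hω, hθp, inv_one, one_mul]
      · rwa [inv_mul_cancel_right₀ hθ0]
    · rintro ⟨ω, h, rfl⟩
      exact (hXYθ (hXp h)).1 h
  have hYcard : Y.card = X.card := by
    rw [hYX, Finset.card_image_of_injective _ (mul_left_injective₀ hθ0)]
  obtain ⟨ω₀, hω₀⟩ : X.Nonempty := Finset.card_pos.1 (by omega)
  have hstable : (∀ ω ∈ X, ω * θ ∈ X) → θ = 1 := by
    intro h
    by_contra hθ1
    have := le_card_of_mul_mem hp hω₀ (hne0 (hXp hω₀)) hθp hθ1 h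
    omega
  by_cases hγ0 : γ = 0
  · have hθ1 : θ = 1 := hstable fun ω hω => by
      rw [hXY hγ0]
      exact (hXYθ (hXp hω)).1 hω
    have h1 := hBτ hω
    have h2 := key hω
    rw [hθ1, mul_one] at h1
    rw [hγ0, mul_zero, h1, sub_eq_zero] at h2
    exact h2.symm
  exfalso
  have hθ1 : θ ≠ 1 := by
    intro h
    have h1 := hcover hγ0
    rw [hYX, h] at h1
    simp only [mul_one, Finset.image_id', Finset.union_idempotent] at h1
    omega
  have hunion : (X ∪ Y).card = p := by
    refine le_antisymm ?_ (hcover hγ0)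
    rw [← hM]
    refine Finset.card_le_card fun ω hω => hmemM.2 ?_
    rcases Finset.mem_union.1 hω with h | h
    exacts [hXp h, hYp h]
  have hinter : (X ∩ Y).card = 2 * X.card - p := by
    have := Finset.card_union_add_card_inter X Y
    omega
  have hroot : ∀ ω ∈ X, (classPart N p A (u * ω)).card = 1 →
      (ω⁻¹ * (classPart N p A (u * ω)).sum) ^ N = 1 := by
    intro ω hω h
    obtain ⟨x, hx⟩ := Multiset.card_eq_one.1 h
    rw [hx, Multiset.sum_singleton, mul_pow, hAN x (Multiset.mem_of_le (classPart_le _ _ _ _)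
      (by rw [hx]; exact Multiset.mem_singleton_self x)), inv_pow, hd, pow_mul, hXp hω]
    simp
  have hcards : ∑ ω ∈ X, (classPart N p A (u * ω)).card ≤ 4 := by
    rw [← Multiset.card_sum]
    exact (Multiset.card_le_card (sum_classPart_mul_le hu X)).trans hA4
  have hone : ∀ ω ∈ X, 1 ≤ (classPart N p A (u * ω)).card := fun ω hω =>
    Multiset.card_pos.2 ((mem_hitSet hp).1 hω).2
  have hp6 : p ≠ 6 := by rintro rfl; revert hp; decide
  rcases (show 2 * X.card = p + 1 ∨ (p = 5 ∧ X.card = 4) by omega) with hk | ⟨hp5', hk⟩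
  · obtain ⟨j, hj⟩ := Finset.card_eq_one.1 (show (X ∩ Y).card = 1 by omega)
    have hjX : j ∈ X := (Finset.mem_inter.1 (hj ▸ Finset.mem_singleton_self j)).1
    have hjXY : ∀ {ω : L}, ω ∈ X → ω ∈ Y → ω = j := fun h1 h2 =>
      Finset.mem_singleton.1 (hj ▸ Finset.mem_inter.2 ⟨h1, h2⟩)
    have e1 : ∀ ω ∈ X, ω ≠ j → (classPart N p A (u * ω)).sum = ω * γ := by
      intro ω hω hωj
      have h1 : (classPart N p B (u * ω)).sum = 0 :=
        not_not.1 fun h => hωj (hjXY hω ((hYiff (hXp hω)).2 h))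
      rw [← key (hXp hω), h1, sub_zero]
    have e2 : ∀ ω ∈ X, ω * θ ≠ j → τ (classPart N p A (u * ω)).sum = -(ω * θ * γ) := by
      intro ω hω hωj
      have h1 : (classPart N p A (u * (ω * θ))).sum = 0 :=
        not_not.1 fun h => hωj (hjXY ((hXiff (hmulp (hXp hω))).2 h) ((hXYθ (hXp hω)).1 hω))
      have h2 := key (hmulp (hXp hω))
      rw [h1, hBτ (hXp hω)] at h2
      linear_combination -h2
    obtain ⟨ω₁, hω₁, hω₁j, hω₁θ⟩ : ∃ ω₁ ∈ X, ω₁ ≠ j ∧ ω₁ * θ ≠ j := by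
      by_contra! h
      have : X ⊆ {j, j * θ⁻¹} := by
        intro ω hω
        rw [Finset.mem_insert, Finset.mem_singleton]
        by_cases h1 : ω = j
        · exact Or.inl h1
        · right
          rw [← h ω hω h1, mul_inv_cancel_right₀ hθ0]
      have := (Finset.card_le_card this).trans Finset.card_le_two
      omega
    have hτγ : τ γ = -(θ * γ) := by
      have := e2 ω₁ hω₁ hω₁θ
      rw [e1 ω₁ hω₁ hω₁j, map_mul, hτp _ (hXp hω₁)] at this
      apply mul_left_cancel₀ (hne0 (hXp hω₁))
      rw [this]
      ring
    have hjθ : j * θ ≠ j := fun h => hθ1 (mul_left_cancel₀ (hne0 (hXp hjX)) (by rw [h, mul_one]))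
    have e3 : ∀ ω ∈ X, (classPart N p A (u * ω)).sum = ω * γ := by
      intro ω hω
      by_cases h : ω = j
      · subst h
        apply hinj
        rw [e2 ω hω hjθ, map_mul, hτp _ (hXp hω), hτγ]
        ring
      · exact e1 ω hω h
    obtain ⟨ω₂, hω₂, hω₂1⟩ : ∃ ω ∈ X, (classPart N p A (u * ω)).card = 1 := by
      by_contra! h
      have : ∑ ω ∈ X, 2 ≤ ∑ ω ∈ X, (classPart N p A (u * ω)).card :=
        Finset.sum_le_sum fun ω hω => by
          have := hone ω hω
          have := h ω hω
          omega
      rw [Finset.sum_const, smul_eq_mul] at this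
      omega
    have hγN := hroot ω₂ hω₂ hω₂1
    rw [e3 ω₂ hω₂, inv_mul_cancel_left₀ (hne0 (hXp hω₂))] at hγN
    exact hA.not_forall_sum_eq hp hN hN2 hpN hζ hu hγN hX e3
  · subst hp5'
    have hall : ∀ ω ∈ X, (classPart N 5 A (u * ω)).card = 1 := by
      by_contra! h
      obtain ⟨ω₁, hω₁, h1⟩ := h
      have : ∑ ω ∈ X, 1 < ∑ ω ∈ X, (classPart N 5 A (u * ω)).card :=
        Finset.sum_lt_sum hone ⟨ω₁, hω₁, by have := hone ω₁ hω₁; omega⟩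
      rw [Finset.sum_const, smul_eq_mul] at this
      omega
    obtain ⟨m, hm5, hmX, hmuniq⟩ : ∃ m : L, m ^ 5 = 1 ∧ m ∉ X ∧ ∀ ω : L, ω ^ 5 = 1 → ω ≠ m →
        ω ∈ X := by
      have hXM : X ⊆ Polynomial.nthRootsFinset 5 (1 : L) := fun ω hω => hmemM.2 (hXp hω)
      obtain ⟨m, hm⟩ := Finset.card_eq_one.1
        (show (Polynomial.nthRootsFinset 5 (1 : L) \ X).card = 1 by
          rw [Finset.card_sdiff_of_subset hXM]; omega)
      have hmm := Finset.mem_sdiff.1 (hm ▸ Finset.mem_singleton_self m)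
      refine ⟨m, hmemM.1 hmm.1, hmm.2, fun ω hω hne => ?_⟩
      by_contra h
      exact hne (Finset.mem_singleton.1 (hm ▸ Finset.mem_sdiff.2 ⟨hmemM.2 hω, h⟩))
    have hm0 := hne0 hm5
    have hθpr : IsPrimitiveRoot θ 5 := by
      have := IsPrimitiveRoot.orderOf θ
      rwa [orderOf_eq_prime_iff (hp := ⟨hp⟩) |>.2 ⟨hθp, hθ1⟩] at this
    have hpow : ∀ i : ℕ, (m * θ ^ i) ^ 5 = 1 := fun i => by
      rw [mul_pow, hm5, ← pow_mul, mul_comm i, pow_mul, hθp, one_pow, one_mul]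
    have hXi : ∀ i : ℕ, 0 < i → i < 5 → m * θ ^ i ∈ X := by
      intro i hi hi5
      refine hmuniq _ (hpow i) fun h => ?_
      exact hθpr.pow_ne_one_of_pos_of_lt hi.ne' hi5 (mul_left_cancel₀ hm0 (by rw [h, mul_one]))
    let a : ℕ → L := fun i => (m * θ ^ i)⁻¹ * (classPart N 5 A (u * (m * θ ^ i))).sum
    have haroot : ∀ i : ℕ, 0 < i → i < 5 → a i ^ N = 1 := fun i h1 h2 =>
      hroot _ (hXi i h1 h2) (hall _ (hXi i h1 h2))
    have ha0 : a 0 = 0 := by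
      have : (classPart N 5 A (u * (m * θ ^ 0))).sum = 0 :=
        not_not.1 fun h => hmX (by simpa using (hXiff (hpow 0)).2 h)
      simp only [a, this, mul_zero]
    have hrec : ∀ i : ℕ, a (i + 1) - θ⁻¹ * τ (a i) = γ := by
      intro i
      have h1 := key (hpow (i + 1))
      have h2 : m * θ ^ (i + 1) = m * θ ^ i * θ := by ring
      have h3 : (classPart N 5 B (u * (m * θ ^ (i + 1)))).sum
          = τ (classPart N 5 A (u * (m * θ ^ i))).sum := by rw [h2, hBτ (hpow i)]
      rw [h3] at h1
      simp only [a, map_mul, map_inv₀, hτp _ (hpow i)]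
      have h4 := hne0 (hpow i)
      have h5 := hne0 (hpow (i + 1))
      rw [h2] at h1 h5 ⊢
      have h6 : (m * θ ^ i * θ)⁻¹ = θ⁻¹ * (m * θ ^ i)⁻¹ := mul_inv_rev _ _
      apply mul_left_cancel₀ h5
      rw [← h1, mul_sub, mul_inv_cancel_left₀ h5, ← mul_assoc θ⁻¹, ← h6, mul_inv_cancel_left₀ h5]
    have hτroot : ∀ x : L, x ^ N = 1 → (θ⁻¹ * τ x) ^ N = 1 := by
      intro x hx
      rw [mul_pow, ← map_pow, hx, map_one, inv_pow, hd, pow_mul, hθp]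
      simp
    have hneg : ∀ x : L, x ^ N = 1 → (-x) ^ N = 1 := fun x hx => by
      rw [(even_iff_two_dvd.2 hN2).neg_pow, hx]
    have hγ1 : γ = a 1 := by
      rw [← hrec 0, ha0]
      simp
    have h1N := haroot 1 (by norm_num) (by norm_num)
    have h2N := haroot 2 (by norm_num) (by norm_num)
    have h3N := haroot 3 (by norm_num) (by norm_num)
    have c2 := cube_eq_of_add_add_eq_zero hN hN2 hζ h1N (hτroot _ h1N) (hneg _ h2N)
      (by linear_combination -hγ1 - hrec 1)
    have c3 := cube_eq_of_add_add_eq_zero hN hN2 hζ h1N (hτroot _ h2N) (hneg _ h3N)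
      (by linear_combination -hγ1 - hrec 2)
    have hcube : a 1 ^ 3 = -a 2 ^ 3 := by rw [c2.1, c2.2]; ring
    have hτcube := congrArg τ hcube
    rw [map_neg, map_pow, map_pow] at hτcube
    have h0 : a 1 ^ 3 = 0 := by
      have e1 := c2.1
      have e2 := c3.1
      rw [mul_pow] at e1 e2
      have : (2 : L) * a 1 ^ 3 = 0 := by linear_combination e1 + e2 + θ⁻¹ ^ 3 * hτcube
      simpa using this
    exact pow_ne_zero 3 (ne_zero_of_pow_eq_one hN h1N) h0

end Fixed

section Squaring

variable {L : Type*} [Field L] {N : ℕ}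

/-- A proper nontrivial set of fifth roots of unity stable under squaring does not have three
elements. -/
theorem card_ne_three_of_sq_mem {X : Finset L} (hX5 : ∀ ω ∈ X, ω ^ 5 = 1)
    (hsq : ∀ ω ∈ X, ω ^ 2 ∈ X) : X.card ≠ 3 := by
  classical
  intro hX
  obtain ⟨ω, hω, hω1⟩ : ∃ ω ∈ X, ω ≠ 1 := by
    by_contra! h
    have : X ⊆ {1} := fun ω hω => Finset.mem_singleton.2 (h ω hω)
    have := Finset.card_le_card this
    simp at this
    omega
  have hpr : IsPrimitiveRoot ω 5 := by
    have := IsPrimitiveRoot.orderOf ω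
    rwa [orderOf_eq_prime_iff (hp := ⟨Nat.prime_five⟩) |>.2 ⟨hX5 ω hω, hω1⟩] at this
  have h2 := hsq _ hω
  have h4 := hsq _ h2
  have h3 := hsq _ h4
  rw [← pow_mul] at h4 h3
  have h8 : ω ^ (2 * 2 * 2) = ω ^ 3 := by
    rw [show 2 * 2 * 2 = 5 + 3 by norm_num, pow_add, hX5 ω hω, one_mul]
  rw [← pow_mul, h8] at h3
  have hsub : (Finset.Icc 1 4).image (ω ^ ·) ⊆ X := by
    intro y hy
    obtain ⟨i, hi, rfl⟩ := Finset.mem_image.1 hy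
    rw [Finset.mem_Icc] at hi
    obtain ⟨hi1, hi4⟩ := hi
    interval_cases i
    · simpa using hω
    · exact h2
    · exact h3
    · exact h4
  have := Finset.card_le_card hsub
  rw [Finset.card_image_of_injOn, Nat.card_Icc] at this
  · omega
  · intro i hi j hj hij
    rw [Finset.coe_Icc, Set.mem_Icc] at hi hj
    exact hpr.pow_inj (by omega) (by omega) hij

theorem add_add_eq_zero_of_cube_eq {K : Type*} [Field K] {x y g : K} (hxy : x ≠ y) (hxg : x ≠ g)
    (hyg : y ≠ g) (h1 : x ^ 3 = g ^ 3) (h2 : y ^ 3 = g ^ 3) : x + y + g = 0 := by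
  have e1 : x ^ 2 + x * g + g ^ 2 = 0 := by
    apply mul_left_cancel₀ (sub_ne_zero.2 hxg)
    linear_combination h1
  have e2 : y ^ 2 + y * g + g ^ 2 = 0 := by
    apply mul_left_cancel₀ (sub_ne_zero.2 hyg)
    linear_combination h2
  apply mul_left_cancel₀ (sub_ne_zero.2 hxy)
  linear_combination e1 - e2

variable [CharZero L]

/-- If `x + y` is not a sum of fewer than two `N`-th roots of unity and `τ` swaps `x` and `y`, then
`x + y - σ (x + y)` is not an `N`-th root of unity fixed by `τ` with the same `5`-primary part
as `x` and `y`. -/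
theorem IsMinimalRep.add_sub_map_ne (hN : N ≠ 0) (hN2 : 2 ∣ N) {ζ : L} (hζ : IsPrimitiveRoot ζ N)
    (h5N : 5 ∣ N) {x y γ u : L} (hxy : IsMinimalRep N {x, y}) (hne : x ≠ y) (hγ : γ ^ N = 1)
    {E : Type*} [EquivLike E L L] [RingEquivClass E L L] {σ τ : E}
    (hcomm : ∀ z : L, σ (τ z) = τ (σ z)) (hτx : τ x = y) (hτy : τ y = x) (hτγ : τ γ = γ)
    (hσu : σ u = u) (hxu : primaryPart N 5 x = u) (hyu : primaryPart N 5 y = u)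
    (hγu : primaryPart N 5 γ = u) : x + y - σ (x + y) ≠ γ := by
  classical
  intro h
  rw [map_add] at h
  have hxN : x ^ N = 1 := hxy.pow_eq_one x (by simp)
  have hyN : y ^ N = 1 := hxy.pow_eq_one y (by simp)
  have hσN : ∀ z : L, z ^ N = 1 → σ z ^ N = 1 := fun z hz => by rw [← map_pow, hz, map_one]
  have hneg : ∀ z : L, z ^ N = 1 → (-z) ^ N = 1 := fun z hz => by
    rw [(even_iff_two_dvd.2 hN2).neg_pow, hz]
  have hroot : (x + y) ^ N ≠ 1 := by
    have := hxy.sum_pow_ne_one (by simp)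
    simpa using this
  have hsum0 : x + y ≠ 0 := by
    have := hxy.sum_ne_zero (by simp)
    simpa using this
  have hσsum0 : σ x + σ y ≠ 0 := by
    rw [← map_add, ne_eq, map_eq_zero_iff σ (EquivLike.injective σ)]
    exact hsum0
  have hτσx : τ (σ x) = σ y := by rw [← hcomm, hτx]
  have hτσy : τ (σ y) = σ x := by rw [← hcomm, hτy]
  have hσne : σ x ≠ σ y := fun h => hne (EquivLike.injective σ h)
  have swap_ne : ∀ {a b c : L}, τ a = b → τ c = c → a ≠ b → a ≠ c := by
    rintro a b c hab hc hab' rfl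
    exact hab' (hc.symm.trans hab)
  have hτnγ : τ (-γ) = -γ := by rw [map_neg, hτγ]
  have hcase : ∀ a a' b : L, a + a' = x + y → τ a = a' → τ a' = a → a ≠ a' → a' ^ N = 1 →
      b ^ N = 1 → a' - b - γ = 0 → False := by
    intro a a' b hs hτa hτa' haa' ha'N hbN h0
    have h1 := cube_eq_of_add_add_eq_zero hN hN2 hζ ha'N (hneg _ hbN) (hneg _ hγ)
      (by linear_combination h0)
    have h2 : a' ^ 3 = (-γ) ^ 3 := h1.1.trans h1.2
    have h3 := congrArg τ h2
    rw [map_pow, map_pow, hτnγ, hτa'] at h3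
    have h4 := add_add_eq_zero_of_cube_eq haa' (swap_ne hτa hτnγ haa')
      (swap_ne hτa' hτnγ haa'.symm) h3 h2
    apply hroot
    rw [← hs, show a + a' = γ by linear_combination h4, hγ]
  set V : Multiset L := {x, y, -σ x, -σ y, -γ} with hVdef
  have hmemV : ∀ {z : L}, z ∈ V ↔ z = x ∨ z = y ∨ z = -σ x ∨ z = -σ y ∨ z = -γ := by
    intro z
    simp [hVdef]
  have hVN : ∀ z ∈ V, z ^ N = 1 := by
    intro z hz
    rcases hmemV.1 hz with rfl | rfl | rfl | rfl | rfl
    exacts [hxN, hyN, hneg _ (hσN _ hxN), hneg _ (hσN _ hyN), hneg _ hγ]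
  have hVsum : V.sum = 0 := by
    simp only [hVdef, Multiset.insert_eq_cons, Multiset.sum_cons, Multiset.sum_singleton]
    linear_combination h
  have hVcard : V.card = 5 := by simp [hVdef]
  have hpair : ∀ w : L, w ∈ V → -w ∈ V → False := by
    intro w hw hw'
    have hw0 : w ≠ -w := self_ne_neg.2 (ne_zero_of_pow_eq_one hN (hVN w hw))
    have f1 : x ≠ γ := swap_ne hτx hτγ hne
    have f2 : y ≠ γ := swap_ne hτy hτγ hne.symm
    have f3 : σ x ≠ -γ := swap_ne hτσx hτnγ hσne
    have f4 : σ y ≠ -γ := swap_ne hτσy hτnγ hσne.symm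
    have g1 : x ≠ σ x := fun e => hcase x y (σ y) rfl hτx hτy hne hyN (hσN _ hyN)
      (by linear_combination h - e)
    have g2 : x ≠ σ y := fun e => hcase x y (σ x) rfl hτx hτy hne hyN (hσN _ hxN)
      (by linear_combination h - e)
    have g3 : y ≠ σ x := fun e => hcase y x (σ y) (add_comm _ _) hτy hτx hne.symm hxN (hσN _ hyN)
      (by linear_combination h - e)
    have g4 : y ≠ σ y := fun e => hcase y x (σ x) (add_comm _ _) hτy hτx hne.symm hxN (hσN _ hxN)
      (by linear_combination h - e)
    rw [hmemV] at hw hw'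
    have e1 : x ≠ -y := fun e => hsum0 (by linear_combination e)
    have e2 : σ x ≠ -σ y := fun e => hσsum0 (by linear_combination e)
    rcases hw with hw | hw | hw | hw | hw <;> rcases hw' with hw' | hw' | hw' | hw' | hw' <;>
    first
    | exact hw0 (hw.trans hw'.symm)
    | exact e1 (by linear_combination -hw - hw')
    | exact e2 (by linear_combination hw + hw')
    | exact f1 (by linear_combination -hw - hw')
    | exact f2 (by linear_combination -hw - hw')
    | exact f3 (by linear_combination hw + hw')
    | exact f4 (by linear_combination hw + hw')
    | exact g1 (by linear_combination -hw - hw')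
    | exact g2 (by linear_combination -hw - hw')
    | exact g3 (by linear_combination -hw - hw')
    | exact g4 (by linear_combination -hw - hw')
  rcases exists_le_of_sum_eq_zero hN hN2 hζ hVN (by simp [hVdef]) hVsum with
    ⟨p, hp, hp5, hpN, hcov⟩ | ⟨w, hw⟩ | ⟨a, b, c, habc, h0, -⟩
  · have hp5' : p = 5 := by
      have := hcov.le_card hN hp hpN hζ hVN
      omega
    subst hp5'
    have hall : ∀ z ∈ V, primaryPart N 5 z = u := by
      have hn := fun z : L => primaryPart_neg_of_ne_two hN2 hp (by norm_num) z
      intro z hz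
      rcases hmemV.1 hz with rfl | rfl | rfl | rfl | rfl
      · exact hxu
      · exact hyu
      · rw [hn, ← map_primaryPart, hxu, hσu]
      · rw [hn, ← map_primaryPart, hyu, hσu]
      · rw [hn, hγu]
    obtain ⟨w, hw⟩ := hcov
    obtain ⟨d, hd⟩ := id h5N
    have hpr : IsPrimitiveRoot (ζ ^ d) 5 := hζ.pow (Nat.pos_of_ne_zero hN) (by rw [hd, mul_comm])
    obtain ⟨z₁, hz₁, h1⟩ := hw 1 (one_pow _)
    obtain ⟨z₂, hz₂, h2⟩ := hw _ hpr.pow_eq_one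
    rw [hall z₁ hz₁, mul_one] at h1
    rw [hall z₂ hz₂, ← h1] at h2
    have hu0 : u ≠ 0 := hxu ▸ pow_ne_zero _ (ne_zero_of_pow_eq_one hN hxN)
    exact hpr.ne_one (by norm_num) (mul_left_cancel₀ hu0 (by rw [← h2, mul_one]))
  · exact hpair w (Multiset.mem_of_le hw (by simp)) (Multiset.mem_of_le hw (by simp))
  · obtain ⟨R, hR⟩ := Multiset.le_iff_exists_add.1 habc
    have hc := congrArg Multiset.card hR
    rw [hVcard] at hc
    simp only [Multiset.insert_eq_cons, Multiset.card_add, Multiset.card_cons,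
      Multiset.card_singleton] at hc
    obtain ⟨d, e, rfl⟩ := Multiset.card_eq_two.1 (show R.card = 2 by omega)
    have hs := congrArg Multiset.sum hR
    rw [hVsum] at hs
    simp only [Multiset.insert_eq_cons, Multiset.sum_add, Multiset.sum_cons,
      Multiset.sum_singleton] at hs
    have hde : e = -d := by linear_combination -h0 - hs
    subst hde
    exact hpair d (by rw [hR]; simp) (by rw [hR]; simp)

end Squaring

section NoSquaring

variable {L : Type*} [Field L] {N : ℕ} {A : Multiset L} {u : L}

theorem hitSet_mul_inv {p : ℕ} [DecidableEq L] (hp : p.Prime) {θ : L} (hθ : θ ^ p = 1) :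
    hitSet N p A (u * θ⁻¹) = (hitSet N p A u).image (· * θ) := by
  have hθ0 := ne_zero_of_pow_eq_one hp.ne_zero hθ
  ext ω
  rw [mem_hitSet hp, Finset.mem_image]
  constructor
  · rintro ⟨h1, h2⟩
    refine ⟨ω * θ⁻¹, (mem_hitSet hp).2 ⟨?_, ?_⟩, inv_mul_cancel_right₀ hθ0 _⟩
    · rw [mul_pow, inv_pow, h1, hθ, inv_one, one_mul]
    · rwa [mul_comm ω, ← mul_assoc]
  · rintro ⟨ω, h, rfl⟩
    obtain ⟨h1, h2⟩ := (mem_hitSet hp).1 h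
    refine ⟨by rw [mul_pow, h1, hθ, one_mul], ?_⟩
    rwa [mul_assoc, mul_comm ω, inv_mul_cancel_left₀ hθ0]

variable [CharZero L]

theorem IsMinimalRep.not_map_sq_of_map_eq (hA : IsMinimalRep N A) (hN : N ≠ 0) (hN2 : 2 ∣ N)
    {ζ : L} (hζ : IsPrimitiveRoot ζ N) (h5N : 5 ∣ N) (hX : (hitSet N 5 A u).card = 3)
    {x y ω₀ : L} (hω₀ : ω₀ ^ 5 = 1) (hclass : classPart N 5 A (u * ω₀) = {x, y}) (hne : x ≠ y)
    (hone : ∀ ω ∈ hitSet N 5 A u, ω ≠ ω₀ → (classPart N 5 A (u * ω)).card = 1)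
    {E : Type*} [EquivLike E L L] [RingEquivClass E L L] {σ τ : E} (hσ : σ A.sum = A.sum)
    (hcomm : ∀ z : L, σ (τ z) = τ (σ z)) (hτx : τ x = y) (hτy : τ y = x)
    (hτ5 : ∀ ω : L, ω ^ 5 = 1 → τ ω = ω)
    (hτ : ∀ ω : L, ω ^ 5 = 1 → τ (classPart N 5 A (u * ω)).sum = (classPart N 5 A (u * ω)).sum)
    (hσu : σ u = u) : ¬ ∀ ω : L, ω ^ 5 = 1 → σ ω = ω ^ 2 := by
  classical
  intro hsq
  have hp := Nat.prime_five
  have hinj : Function.Injective σ := EquivLike.injective σ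
  have hAN := hA.pow_eq_one
  have hu : u ≠ 0 := ne_zero_of_hitSet_nonempty hN hAN hp (Finset.card_pos.1 (by omega))
  obtain ⟨d, hd⟩ := id h5N
  have hpr : IsPrimitiveRoot (ζ ^ d) 5 := hζ.pow (Nat.pos_of_ne_zero hN) (by rw [hd, mul_comm])
  have hM : (Polynomial.nthRootsFinset 5 (1 : L)).card = 5 := hpr.card_nthRootsFinset
  have hmemM : ∀ {ω : L}, ω ∈ Polynomial.nthRootsFinset 5 (1 : L) ↔ ω ^ 5 = 1 :=
    Polynomial.mem_nthRootsFinset hp.pos _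
  have hne0 : ∀ {ω : L}, ω ^ 5 = 1 → ω ≠ 0 := ne_zero_of_pow_eq_one hp.ne_zero
  have hωN : ∀ {ω : L}, ω ^ 5 = 1 → ω ^ N = 1 := fun h => by rw [hd, pow_mul, h, one_pow]
  have hsq5 : ∀ {ω : L}, ω ^ 5 = 1 → (ω ^ 2) ^ 5 = 1 := fun h => by
    rw [← pow_mul, mul_comm, pow_mul, h, one_pow]
  have hxy : IsMinimalRep N {x, y} := hclass ▸ hA.of_le (classPart_le _ _ _ _)
  have hroot : (x + y) ^ N ≠ 1 := by
    have := hxy.sum_pow_ne_one (by simp)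
    simpa using this
  have hsum₀ : (classPart N 5 A (u * ω₀)).sum = x + y := by rw [hclass]; simp
  have hB := hA.map σ hσ
  have hYX := hitSet_map (N := N) (A := A) hp σ u
  set B := A.map σ with hBdef
  rw [hσu] at hYX
  set X := hitSet N 5 A u with hXdef
  set Y := hitSet N 5 B u with hYdef
  have hXiff : ∀ {ω : L}, ω ^ 5 = 1 → (ω ∈ X ↔ (classPart N 5 A (u * ω)).sum ≠ 0) :=
    hA.mem_hitSet_iff hp
  have hYiff : ∀ {ω : L}, ω ^ 5 = 1 → (ω ∈ Y ↔ (classPart N 5 B (u * ω)).sum ≠ 0) :=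
    hB.mem_hitSet_iff hp
  have hXp : ∀ {ω : L}, ω ∈ X → ω ^ 5 = 1 := fun h => ((mem_hitSet hp).1 h).1
  have hYp : ∀ {ω : L}, ω ∈ Y → ω ^ 5 = 1 := fun h => ((mem_hitSet hp).1 h).1
  have hYcard : Y.card = 3 := by rw [hYX, Finset.card_map, hX]
  have hXY : ∀ {ω : L}, ω ∈ X → ω ^ 2 ∈ Y := by
    intro ω hω
    rw [hYX, ← hsq ω (hXp hω)]
    exact Finset.mem_map_of_mem _ hω
  set γ := (classPart N 5 A u).sum - (classPart N 5 B u).sum with hγ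
  have key : ∀ {ω : L}, ω ^ 5 = 1 →
      (classPart N 5 A (u * ω)).sum - (classPart N 5 B (u * ω)).sum = ω * γ := fun h =>
    classPart_sum_sub_classPart_sum hN hζ hAN hB.pow_eq_one
      (by rw [hBdef, ← map_multiset_sum, hσ]) hp h5N h u
  have hBσ : ∀ {ω : L}, ω ^ 5 = 1 →
      (classPart N 5 B (u * ω ^ 2)).sum = σ (classPart N 5 A (u * ω)).sum := by
    intro ω hω
    have : u * ω ^ 2 = σ (u * ω) := by rw [map_mul, hσu, hsq ω hω]
    rw [this, hBdef, classPart_map, ← map_multiset_sum]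
  have hγ0 : γ ≠ 0 := by
    intro hγ0
    refine card_ne_three_of_sq_mem (X := X) (fun _ => hXp) (fun ω hω => ?_) hX
    have h1 := key (hsq5 (hXp hω))
    rw [hγ0, mul_zero, sub_eq_zero] at h1
    rw [hXiff (hsq5 (hXp hω)), h1, ← hYiff (hsq5 (hXp hω))]
    exact hXY hω
  have hcover : 5 ≤ (X ∪ Y).card := by
    rw [← hM]
    refine Finset.card_le_card fun ω hω => ?_
    rw [hmemM] at hω
    rw [Finset.mem_union, hXiff hω, hYiff hω]
    by_contra! h
    have := key hω
    rw [h.1, h.2, sub_zero, eq_comm, mul_eq_zero] at this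
    exact this.elim (hne0 hω) hγ0
  have hunion : (X ∪ Y).card = 5 := by
    refine le_antisymm ?_ hcover
    rw [← hM]
    refine Finset.card_le_card fun ω hω => hmemM.2 ?_
    rcases Finset.mem_union.1 hω with h | h
    exacts [hXp h, hYp h]
  obtain ⟨j, hj⟩ := Finset.card_eq_one.1 (show (X ∩ Y).card = 1 by
    have := Finset.card_union_add_card_inter X Y
    omega)
  have hjXY : ∀ {ω : L}, ω ∈ X → ω ∈ Y → ω = j := fun h1 h2 =>
    Finset.mem_singleton.1 (hj ▸ Finset.mem_inter.2 ⟨h1, h2⟩)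
  have e1 : ∀ ω ∈ X, ω ≠ j → (classPart N 5 A (u * ω)).sum = ω * γ := by
    intro ω hω hωj
    have h1 : (classPart N 5 B (u * ω)).sum = 0 :=
      not_not.1 fun h => hωj (hjXY hω ((hYiff (hXp hω)).2 h))
    rw [← key (hXp hω), h1, sub_zero]
  have e2 : ∀ ω ∈ X, ω ^ 2 ≠ j → σ (classPart N 5 A (u * ω)).sum = -(ω ^ 2 * γ) := by
    intro ω hω hωj
    have h1 : (classPart N 5 A (u * ω ^ 2)).sum = 0 :=
      not_not.1 fun h => hωj (hjXY ((hXiff (hsq5 (hXp hω))).2 h) (hXY hω))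
    have h2 := key (hsq5 (hXp hω))
    rw [h1, hBσ (hXp hω)] at h2
    linear_combination -h2
  obtain ⟨ω₁, hω₁, hω₁j, hω₁0⟩ : ∃ ω₁ ∈ X, ω₁ ≠ j ∧ ω₁ ≠ ω₀ := by
    by_contra! h
    have : X ⊆ {j, ω₀} := by
      intro ω hω
      rw [Finset.mem_insert, Finset.mem_singleton]
      exact or_iff_not_imp_left.2 (h ω hω)
    have := (Finset.card_le_card this).trans Finset.card_le_two
    omega
  obtain ⟨z, hz⟩ := Multiset.card_eq_one.1 (hone ω₁ hω₁ hω₁0)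
  have hz1 : z = ω₁ * γ := by rw [← e1 ω₁ hω₁ hω₁j, hz, Multiset.sum_singleton]
  obtain ⟨hzA, hzu⟩ := mem_classPart.1 (hz ▸ Multiset.mem_singleton_self z)
  have h10 := hne0 (hXp hω₁)
  have hγN : γ ^ N = 1 := by
    have := hAN z hzA
    rwa [hz1, mul_pow, hωN (hXp hω₁), one_mul] at this
  have hγu : primaryPart N 5 γ = u := by
    rw [hz1, primaryPart_mul, primaryPart_self hN hp h5N (hXp hω₁), mul_comm] at hzu
    exact mul_right_cancel₀ h10 hzu
  have hτγ : τ γ = γ := by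
    have := hτ ω₁ (hXp hω₁)
    rw [e1 ω₁ hω₁ hω₁j, map_mul, hτ5 _ (hXp hω₁)] at this
    exact mul_left_cancel₀ h10 this
  have hω₀X : ω₀ ∈ X := (mem_hitSet hp).2 ⟨hω₀, by rw [hclass]; simp⟩
  have hj0 : ω₀ = j := by
    by_contra h
    have := e1 ω₀ hω₀X h
    apply hroot
    rw [← hsum₀, this, mul_pow, hωN hω₀, hγN, one_mul]
  have hω₀1 : ω₀ ^ 2 = ω₀ := by
    by_contra h
    have h1 := e2 ω₀ hω₀X (hj0 ▸ h)
    apply hroot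
    apply hinj
    rw [← hsum₀, map_pow, h1, (even_iff_two_dvd.2 hN2).neg_pow, mul_pow, hωN (hsq5 hω₀), hγN,
      map_one, one_mul]
  have hω₀1 : ω₀ = 1 := by
    apply mul_left_cancel₀ (hne0 hω₀)
    rw [← sq, hω₀1, mul_one]
  subst hω₀1
  have hmem : ∀ z, z ∈ ({x, y} : Multiset L) → primaryPart N 5 z = u := fun z hz => by
    have := (mem_classPart.1 (hclass ▸ hz)).2
    rwa [mul_one] at this
  refine hxy.add_sub_map_ne hN hN2 hζ h5N hne hγN hcomm hτx hτy hτγ hσu (hmem x (by simp))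
    (hmem y (by simp)) hγu ?_
  have h1 := key (one_pow 5)
  have h2 := hBσ (one_pow 5)
  rw [one_pow] at h2
  rwa [h2, hsum₀, one_mul] at h1

/-- Suppose `A` has four elements, meeting three classes in a coset of the fifth roots of unity. If
an automorphism `τ` fixing the fifth roots of unity and preserving `A.sum` swaps the two elements in
the same class, then no automorphism preserving `A.sum` and commuting with `τ` squares the fifth
roots of unity. -/
theorem IsMinimalRep.not_map_sq (hA : IsMinimalRep N A) (hA4 : A.card ≤ 4) (hN : N ≠ 0)
    (hN2 : 2 ∣ N) {ζ : L} (hζ : IsPrimitiveRoot ζ N) (h5N : 5 ∣ N)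
    (hX : (hitSet N 5 A u).card = 3)
    {x y ω₀ : L} (hω₀ : ω₀ ^ 5 = 1) (hclass : classPart N 5 A (u * ω₀) = {x, y}) (hne : x ≠ y)
    (hone : ∀ ω ∈ hitSet N 5 A u, ω ≠ ω₀ → (classPart N 5 A (u * ω)).card = 1)
    {E : Type*} [EquivLike E L L] [RingEquivClass E L L] {σ τ : E} (hσ : σ A.sum = A.sum)
    (hτ : τ A.sum = A.sum) (hcomm : ∀ z : L, σ (τ z) = τ (σ z)) (hτx : τ x = y) (hτy : τ y = x)
    (hτ5 : ∀ ω : L, ω ^ 5 = 1 → τ ω = ω) : ¬ ∀ ω : L, ω ^ 5 = 1 → σ ω = ω ^ 2 := by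
  classical
  intro hsq
  have hp := Nat.prime_five
  obtain ⟨θ, hθ5, hθ⟩ := hA.exists_map_eq_mul (u := u) hA4 hN hζ hp le_rfl h5N (by omega) σ hσ
  have hθ0 := ne_zero_of_pow_eq_one hp.ne_zero hθ5
  have hX' := hitSet_mul_inv (N := N) (A := A) (u := u) hp hθ5
  have hc : ∀ ω : L, u * θ⁻¹ * (ω * θ) = u * ω := fun ω => by field_simp
  have hcard : (hitSet N 5 A (u * θ⁻¹)).card = 3 := by
    rw [hX', Finset.card_image_of_injective _ (mul_left_injective₀ hθ0), hX]
  refine hA.not_map_sq_of_map_eq hN hN2 hζ h5N hcard (ω₀ := ω₀ * θ)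
    (by rw [mul_pow, hω₀, hθ5, one_mul]) (by rw [hc, hclass]) hne ?_ hσ hcomm hτx hτy hτ5
    (fun ω hω => hA.classPart_sum_fixed hA4 hN hN2 hζ hp le_rfl h5N (by omega) τ hτ hτ5 hω) ?_ hsq
  · intro ω hω hne'
    rw [hX'] at hω
    obtain ⟨ω', hω', rfl⟩ := Finset.mem_image.1 hω
    rw [hc]
    exact hone ω' hω' fun h => hne' (by rw [h])
  · rw [map_mul, hθ, map_inv₀, hsq θ hθ5]
    field_simp

end NoSquaring

section GaloisGroup

theorem card_le_card_mul_card_stabilizer {α : Type*} {G : Type*} [Group G] [Finite G]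
    [MulAction G α] {x : α} {t : Finset α} (ht : ∀ g : G, g • x ∈ t) :
    Nat.card G ≤ t.card * Nat.card (MulAction.stabilizer G x) := by
  rw [← Subgroup.index_mul_card (MulAction.stabilizer G x), MulAction.index_stabilizer]
  refine Nat.mul_le_mul_right _ ?_
  rw [← Set.ncard_coe_finset t]
  refine Set.ncard_le_ncard ?_ t.finite_toSet
  rintro _ ⟨g, rfl⟩
  exact ht g

variable {L : Type*} [Field L] [CharZero L] {N : ℕ} {A : Multiset L}

theorem IsMinimalRep.exists_lt_card_hitSet (hA : IsMinimalRep N A) (hN : N ≠ 0) (hN2 : 2 ∣ N)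
    {ζ : L} (hζ : IsPrimitiveRoot ζ N) {E : Type*} [EquivLike E L L] [RingEquivClass E L L] (σ : E)
    (hσ : σ A.sum = A.sum) (hne : A.map σ ≠ A) :
    ∃ p : ℕ, p.Prime ∧ 5 ≤ p ∧ p ∣ N ∧ ∃ u : L, p < 2 * (hitSet N p A u).card := by
  classical
  obtain ⟨p, hp, hp5, hpN, u, hu⟩ := hA.exists_coversCoset (hA.map σ hσ) hN hN2 hζ
    (by rw [← map_multiset_sum, hσ]) hne.symm
  refine ⟨p, hp, hp5, hpN, ?_⟩
  obtain ⟨d, hd⟩ := id hpN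
  have hpr : IsPrimitiveRoot (ζ ^ d) p := hζ.pow (Nat.pos_of_ne_zero hN) (by rw [hd, mul_comm])
  have hcov : Polynomial.nthRootsFinset p (1 : L) ⊆
      hitSet N p A u ∪ hitSet N p (A.map σ) u := by
    intro ω hω
    rw [Polynomial.mem_nthRootsFinset hp.pos] at hω
    obtain ⟨x, hx, hxu⟩ := hu ω hω
    have hmem : ∀ C : Multiset L, x ∈ C → ω ∈ hitSet N p C u := fun C hC =>
      (mem_hitSet hp).2 ⟨hω, fun h0 => by simpa [h0] using mem_classPart.2 ⟨hC, hxu⟩⟩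
    rw [Finset.mem_union]
    exact (Multiset.mem_add.1 hx).imp (hmem _) (hmem _)
  have hle := (Finset.card_le_card hcov).trans (Finset.card_union_le _ _)
  rw [hpr.card_nthRootsFinset] at hle
  obtain ⟨v, rfl⟩ := EquivLike.surjective σ u
  rw [hitSet_map hp, Finset.card_map] at hle
  have hodd := hp.eq_two_or_odd
  rcases (show p < 2 * (hitSet N p A (σ v)).card ∨ p < 2 * (hitSet N p A v).card by omega)
    with h | h
  exacts [⟨_, h⟩, ⟨_, h⟩]

variable {F : Type*} [Field F] [Algebra F L] [Finite (L ≃ₐ[F] L)]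

/-- A commutative group of automorphisms preserving a sum of at most four roots of unity, and
acting faithfully on the summands of a minimal representation, has at most six elements. -/
theorem IsMinimalRep.card_aut_le_six (hA : IsMinimalRep N A) (hA4 : A.card ≤ 4) (hN : N ≠ 0)
    (hN2 : 2 ∣ N) {ζ : L} (hζ : IsPrimitiveRoot ζ N) (hcomm : ∀ σ τ : L ≃ₐ[F] L, σ * τ = τ * σ)
    (hsum : ∀ σ : L ≃ₐ[F] L, σ A.sum = A.sum)
    (hfaith : ∀ τ : L ≃ₐ[F] L, (∀ x ∈ A, τ x = x) → τ = 1) : Nat.card (L ≃ₐ[F] L) ≤ 6 := by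
  classical
  by_cases hall : ∀ σ : L ≃ₐ[F] L, A.map σ = A
  · have hAc := (Multiset.toFinset_card_le A).trans hA4
    have := card_le_of_faithful_of_commute hcomm A.toFinset ?_ ?_ hAc
    · omega
    · intro σ x hx
      rw [Multiset.mem_toFinset] at hx ⊢
      rw [← hall σ]
      exact Multiset.mem_map_of_mem σ hx
    · intro σ h
      exact hfaith σ fun x hx => h x (Multiset.mem_toFinset.2 hx)
  push Not at hall
  obtain ⟨σ, hσ⟩ := hall
  obtain ⟨p, hp, hp5, hpN, u, hX⟩ := hA.exists_lt_card_hitSet hN hN2 hζ σ (hsum σ) hσ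
  have hu : u ≠ 0 :=
    ne_zero_of_hitSet_nonempty hN hA.pow_eq_one hp (Finset.card_pos.1 (by omega))
  obtain ⟨ξ, hpr⟩ : ∃ ξ : L, IsPrimitiveRoot ξ p := by
    obtain ⟨d, hd⟩ := id hpN
    exact ⟨ζ ^ d, hζ.pow (Nat.pos_of_ne_zero hN) (by rw [hd, mul_comm])⟩
  have : NeZero p := ⟨hp.ne_zero⟩
  have hmemM : ∀ {ω : L}, ω ∈ Polynomial.nthRootsFinset p (1 : L) ↔ ω ^ p = 1 :=
    Polynomial.mem_nthRootsFinset hp.pos _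
  have hpow : ∀ (τ : L ≃ₐ[F] L) (k : ℕ), τ ξ = ξ ^ k → ∀ ω : L, ω ^ p = 1 → τ ω = ω ^ k := by
    intro τ k hτ ω hω
    obtain ⟨i, -, rfl⟩ := hpr.eq_pow_of_pow_eq_one hω
    rw [map_pow, hτ, pow_right_comm]
  set H := MulAction.stabilizer (L ≃ₐ[F] L) ξ with hH
  have hHfix : ∀ τ ∈ H, ∀ ω : L, ω ^ p = 1 → τ ω = ω := fun τ hτ ω hω => by
    have := hpow τ 1 (by rw [pow_one]; exact hτ) ω hω
    rwa [pow_one] at this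
  have hHclass : ∀ τ ∈ H, ∀ ω ∈ hitSet N p A u, (classPart N p A (u * ω)).card = 1 →
      ∀ z ∈ classPart N p A (u * ω), τ z = z := by
    intro τ hτ ω hω h1 z hz
    have := hA.classPart_sum_fixed hA4 hN hN2 hζ hp hp5 hpN hX τ (hsum τ) (hHfix τ hτ)
      ((mem_hitSet hp).1 hω).1
    obtain ⟨w, hw⟩ := Multiset.card_eq_one.1 h1
    rw [hw, Multiset.mem_singleton] at hz
    rwa [hw, Multiset.sum_singleton, ← hz] at this
  have hM1 : ((Polynomial.nthRootsFinset p (1 : L)).erase 1).card = p - 1 := by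
    rw [Finset.card_erase_of_mem (hmemM.2 (one_pow p)), hpr.card_nthRootsFinset]
  have hmem1 : ∀ τ : L ≃ₐ[F] L, τ ξ ∈ (Polynomial.nthRootsFinset p (1 : L)).erase 1 := by
    intro τ
    rw [Finset.mem_erase, hmemM, ← map_pow, hpr.pow_eq_one, map_one]
    exact ⟨fun h => hpr.ne_one hp.one_lt (τ.injective (h.trans (map_one τ).symm)), rfl⟩
  have hbound := card_le_card_mul_card_stabilizer (G := L ≃ₐ[F] L) (x := ξ) hmem1
  rw [hM1, ← hH] at hbound
  have htriv : (∀ τ ∈ H, τ = 1) → Nat.card H = 1 := fun h => by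
    rw [(Subgroup.eq_bot_iff_forall H).2 h, Subgroup.card_bot]
  set S := ∑ ω ∈ hitSet N p A u, classPart N p A (u * ω) with hS
  have hSA : S ≤ A := sum_classPart_mul_le hu _
  have hScard : S.card = ∑ ω ∈ hitSet N p A u, (classPart N p A (u * ω)).card := by
    rw [hS, Multiset.card_sum]
  have hmemS : ∀ {z}, z ∈ S → ∃ ω ∈ hitSet N p A u, z ∈ classPart N p A (u * ω) := fun h =>
    Multiset.mem_sum.1 h
  have hSle := Multiset.card_le_card hSA
  have hXS : (hitSet N p A u).card ≤ S.card := card_hitSet_le_card_sum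
  by_cases hsingle : ∀ ω ∈ hitSet N p A u, (classPart N p A (u * ω)).card = 1
  · have hH1 : Nat.card H = 1 := by
      refine htriv fun τ hτ => hfaith τ ?_
      have hfixS : ∀ z ∈ S, τ z = z := fun z hz => by
        obtain ⟨ω, hω, hz⟩ := hmemS hz
        exact hHclass τ hτ ω hω (hsingle ω hω) z hz
      obtain ⟨R, hR⟩ := Multiset.le_iff_exists_add.1 hSA
      have hRcard : R.card ≤ 1 := by
        have := congrArg Multiset.card hR
        rw [Multiset.card_add] at this
        omega
      have hRsum : τ R.sum = R.sum := by
        have h1 := hsum τ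
        have h2 : τ S.sum = S.sum := by
          rw [map_multiset_sum, Multiset.map_congr rfl hfixS, Multiset.map_id']
        rw [hR, Multiset.sum_add, map_add, h2] at h1
        exact add_left_cancel h1
      intro x hx
      rw [hR, Multiset.mem_add] at hx
      rcases hx with hx | hx
      · exact hfixS x hx
      · obtain ⟨r, rfl⟩ := Multiset.card_eq_one.1
          (show R.card = 1 by have := Multiset.card_pos_iff_exists_mem.2 ⟨x, hx⟩; omega)
        rw [Multiset.mem_singleton] at hx
        rwa [Multiset.sum_singleton, ← hx] at hRsum
    rw [hH1] at hbound
    omega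
  push Not at hsingle
  obtain ⟨ω₀, hω₀, hcard₀⟩ := hsingle
  have hone : ∀ ω ∈ hitSet N p A u, 1 ≤ (classPart N p A (u * ω)).card := fun ω hω =>
    Multiset.card_pos.2 ((mem_hitSet hp).1 hω).2
  have hone₀ := hone ω₀ hω₀
  have hsplit := Finset.add_sum_erase _ (fun ω => (classPart N p A (u * ω)).card) hω₀
  have hge : (hitSet N p A u).card - 1 ≤
      ∑ ω ∈ (hitSet N p A u).erase ω₀, (classPart N p A (u * ω)).card := by
    rw [← Finset.card_erase_of_mem hω₀, Finset.card_eq_sum_ones]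
    exact Finset.sum_le_sum fun ω hω => hone ω (Finset.mem_of_mem_erase hω)
  simp only [← hScard] at hsplit
  have hX3 : (hitSet N p A u).card = 3 := by omega
  have hcard2 : (classPart N p A (u * ω₀)).card = 2 := by omega
  have hS4 : S.card = 4 := by omega
  have hSeq : S = A := Multiset.eq_of_le_of_card_le hSA (by omega)
  have hp6 : p ≠ 6 := by rintro rfl; revert hp; decide
  obtain rfl : p = 5 := by omega
  have hone' : ∀ ω ∈ hitSet N 5 A u, ω ≠ ω₀ → (classPart N 5 A (u * ω)).card = 1 := by
    by_contra! h
    obtain ⟨ω₁, hω₁, hne, h1⟩ := h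
    have hlt : ∑ ω ∈ (hitSet N 5 A u).erase ω₀, 1 <
        ∑ ω ∈ (hitSet N 5 A u).erase ω₀, (classPart N 5 A (u * ω)).card :=
      Finset.sum_lt_sum (fun ω hω => hone ω (Finset.mem_of_mem_erase hω))
        ⟨ω₁, Finset.mem_erase.2 ⟨hne, hω₁⟩, by have := hone ω₁ hω₁; omega⟩
    rw [← Finset.card_eq_sum_ones, Finset.card_erase_of_mem hω₀] at hlt
    omega
  obtain ⟨x, y, hxy⟩ := Multiset.card_eq_two.1 hcard2
  have hω₀5 : ω₀ ^ 5 = 1 := ((mem_hitSet hp).1 hω₀).1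
  have hmin : IsMinimalRep N {x, y} := hxy ▸ hA.of_le (classPart_le _ _ _ _)
  have hτsum : ∀ τ ∈ H, τ x + τ y = x + y := by
    intro τ hτ
    have := hA.classPart_sum_fixed hA4 hN hN2 hζ hp hp5 hpN hX τ (hsum τ) (hHfix τ hτ) hω₀5
    simpa [hxy] using this
  have hτmem : ∀ τ ∈ H, τ x = x ∨ τ x = y := by
    intro τ hτ
    have hs : τ ({x, y} : Multiset L).sum = ({x, y} : Multiset L).sum := by
      simpa using hτsum τ hτ
    have hmap := hmin.map τ hs
    have heq : ({x, y} : Multiset L) = ({x, y} : Multiset L).map τ := by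
      by_contra hne
      obtain ⟨q, hq, hq5, hqN, hcov⟩ := hmin.exists_coversCoset hmap hN hN2 hζ
        (by rw [← map_multiset_sum, hs]) hne
      have := hcov.le_card hN hq hqN hζ fun z hz => (Multiset.mem_add.1 hz).elim
        (hmin.pow_eq_one z) (hmap.pow_eq_one z)
      simp at this
      omega
    have hx : τ x ∈ ({x, y} : Multiset L).map τ := Multiset.mem_map_of_mem τ (by simp)
    rw [← heq] at hx
    simpa using hx
  have hτ1 : ∀ τ ∈ H, τ x = x → τ = 1 := by
    intro τ hτ hx
    have hy : τ y = y := by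
      have := hτsum τ hτ
      rw [hx] at this
      exact add_left_cancel this
    refine hfaith τ fun z hz => ?_
    rw [← hSeq] at hz
    obtain ⟨ω, hω, hz⟩ := hmemS hz
    by_cases h : ω = ω₀
    · rw [h, hxy] at hz
      simp only [Multiset.insert_eq_cons, Multiset.mem_cons, Multiset.mem_singleton] at hz
      rcases hz with rfl | rfl
      exacts [hx, hy]
    · exact hHclass τ hτ ω hω (hone' ω hω h) z hz
  by_cases hfix : ∀ τ ∈ H, τ x = x
  · rw [htriv fun τ hτ => hτ1 τ hτ (hfix τ hτ)] at hbound
    omega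
  push Not at hfix
  obtain ⟨τ, hτ, hτx⟩ := hfix
  have hτxy := (hτmem τ hτ).resolve_left hτx
  have hτyx : τ y = x := by
    have := hτsum τ hτ
    rw [hτxy, add_comm x y] at this
    exact add_left_cancel this
  have hnosq : ∀ σ : L ≃ₐ[F] L, σ ξ ≠ ξ ^ 2 := fun σ h =>
    hA.not_map_sq hA4 hN hN2 hζ hpN hX3 hω₀5 hxy (fun h => hτx (hτxy.trans h.symm)) hone' (hsum σ)
      (hsum τ) (fun z => DFunLike.congr_fun (hcomm σ τ) z) hτxy hτyx (hHfix τ hτ) (hpow σ 2 h)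
  have hbound' := card_le_card_mul_card_stabilizer (G := L ≃ₐ[F] L) (x := ξ)
    fun σ => Finset.mem_erase.2 ⟨hnosq σ, hmem1 σ⟩
  have hHcard := card_le_card_mul_card_stabilizer (G := H) (x := x) (t := {x, y}) fun τ => by
    rw [Finset.mem_insert, Finset.mem_singleton]
    exact hτmem τ τ.2
  have hstab : Nat.card (MulAction.stabilizer H x) = 1 := by
    have hbot : MulAction.stabilizer H x = ⊥ :=
      (Subgroup.eq_bot_iff_forall _).2 fun ρ hρ => Subtype.ext (hτ1 (ρ : L ≃ₐ[F] L) ρ.2 hρ)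
    rw [hbot, Subgroup.card_bot]
  have h2 : ({x, y} : Finset L).card ≤ 2 := Finset.card_le_two
  rw [hstab] at hHcard
  rw [Finset.card_erase_of_mem, hM1, ← hH] at hbound'
  · omega
  · rw [Finset.mem_erase, hmemM, pow_right_comm, hpr.pow_eq_one, one_pow]
    exact ⟨hpr.pow_ne_one_of_pos_of_lt (by norm_num) (by norm_num), rfl⟩

end GaloisGroup

section Descent

variable {L : Type*} [Field L] [CharZero L]

/-- A sum of `pM`-th roots of unity lying in the `ℚ`-span of the `M`-th roots of unity is a sum of
at most as many `M`-th roots of unity. -/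
theorem exists_multiset_of_sum_mem_span {p M : ℕ} (hp : p.Prime) (hM : M ≠ 0) (hM2 : 2 ∣ M)
    {ζ : L} (hζ : IsPrimitiveRoot ζ (p * M)) {A : Multiset L} (hA : ∀ x ∈ A, x ^ (p * M) = 1)
    (d : L → ℚ) (hd : A.sum = ∑ y ∈ Polynomial.nthRootsFinset M (1 : L), (d y : L) * y) :
    ∃ B : Multiset L, (∀ x ∈ B, x ^ M = 1) ∧ B.sum = A.sum ∧ B.card ≤ A.card := by
  classical
  set N := p * M with hNdef
  have hN : N ≠ 0 := mul_ne_zero hp.ne_zero hM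
  have hpN : p ∣ N := dvd_mul_right p M
  set s := Polynomial.nthRootsFinset N (1 : L)
  set t := Polynomial.nthRootsFinset M (1 : L)
  have hmems : ∀ {x : L}, x ∈ s ↔ x ^ N = 1 :=
    Polynomial.mem_nthRootsFinset (Nat.pos_of_ne_zero hN) _
  have hmemt : ∀ {x : L}, x ∈ t ↔ x ^ M = 1 :=
    Polynomial.mem_nthRootsFinset (Nat.pos_of_ne_zero hM) _
  have hts : t ⊆ s := fun x hx => by
    rw [hmems, hNdef, mul_comm, pow_mul, hmemt.1 hx, one_pow]
  have hMp : ∀ {x : L}, x ^ N = 1 → x ^ M = primaryPart N p x ^ M := fun {x} hx => by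
    rw [primaryPart, pow_right_comm]
    exact (primaryPart_self hN hp hpN (by rw [← pow_mul, mul_comm, ← hNdef, hx])).symm
  let c : L → ℚ := fun x => (A.count x : ℚ) - if x ∈ t then d x else 0
  have hc : ∀ P : L → Prop, ∑ x ∈ s with P x, (c x : L) * x
      = (A.filter P).sum - ∑ x ∈ t with P x, (d x : L) * x := by
    intro P
    have h1 : (A.filter P).sum = ∑ x ∈ s with P x, (A.count x : L) * x := by
      rw [Finset.sum_multiset_count_of_subset (A.filter P) (s.filter P)]
      · refine Finset.sum_congr rfl fun x hx => ?_
        rw [Multiset.count_filter_of_pos (Finset.mem_filter.1 hx).2, nsmul_eq_mul]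
      · intro x hx
        rw [Multiset.mem_toFinset, Multiset.mem_filter] at hx
        exact Finset.mem_filter.2 ⟨hmems.2 (hA x hx.1), hx.2⟩
    have h2 : ∑ x ∈ t with P x, (d x : L) * x
        = ∑ x ∈ s with P x, ((if x ∈ t then d x else 0 : ℚ) : L) * x := by
      rw [← Finset.sum_subset (Finset.filter_subset_filter P hts)]
      · refine Finset.sum_congr rfl fun x hx => ?_
        rw [if_pos (Finset.mem_filter.1 hx).1]
      · intro x hx hxt
        rw [if_neg fun h => hxt (Finset.mem_filter.2 ⟨h, (Finset.mem_filter.1 hx).2⟩),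
          Rat.cast_zero, zero_mul]
    rw [h1, h2, ← Finset.sum_sub_distrib]
    refine Finset.sum_congr rfl fun x _ => ?_
    simp only [c, Rat.cast_sub, Rat.cast_natCast, sub_mul]
  have h0 : ∑ x ∈ s, (c x : L) * x = 0 := by
    have := hc fun _ => True
    simpa [hd, Multiset.filter_eq_self.2] using this
  have key : ∀ {ω : L}, ω ^ p = 1 → ∀ u : L,
      (classPart N p A (u * ω)).sum - ∑ x ∈ t with primaryPart N p x = u * ω, (d x : L) * x
        = ω * ((classPart N p A u).sum - ∑ x ∈ t with primaryPart N p x = u, (d x : L) * x) := by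
    intro ω hω u
    have := sum_filter_primaryPart_mul hN hζ s (fun _ => hmems.1) c h0 hp hpN hω u
    rw [hc, hc] at this
    exact this
  have hpr : IsPrimitiveRoot (ζ ^ M) p := hζ.pow (Nat.pos_of_ne_zero hN) (by rw [hNdef, mul_comm])
  set ω := ζ ^ M
  have hω1 : ω ≠ 1 := hpr.ne_one hp.one_lt
  have hω0 : ω ≠ 0 := hpr.ne_zero hp.ne_zero
  by_cases hpM : p ∣ M
  · have hωM : ω ^ M = 1 := by
      obtain ⟨k, rfl⟩ := hpM
      rw [pow_mul, hpr.pow_eq_one, one_pow]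
    have hωN : ω ^ N = 1 := by rw [hNdef, pow_mul, hpr.pow_eq_one, one_pow]
    set I := s.filter fun u => ¬ u ^ M = 1
    have hI : ∀ {u}, u ∈ I ↔ u ^ N = 1 ∧ ¬ u ^ M = 1 := by
      intro u
      rw [Finset.mem_filter, hmems]
    have hfilter : A.filter (fun x => ¬ x ^ M = 1) = ∑ u ∈ I, classPart N p A u := by
      rw [sum_classPart]
      refine Multiset.filter_congr fun x hx => ?_
      rw [hI, ← hMp (hA x hx), primaryPart, pow_right_comm, hA x hx, one_pow]
      simp
    have hD : ∀ u ∈ I, ∑ x ∈ t with primaryPart N p x = u, (d x : L) * x = 0 := by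
      intro u hu
      rw [Finset.filter_false_of_mem, Finset.sum_empty]
      rintro x hx rfl
      exact (hI.1 hu).2 (by rw [← hMp (hmems.1 (hts hx)), hmemt.1 hx])
    have hIω : ∀ u ∈ I, u * ω ∈ I := by
      intro u hu
      rw [hI, mul_pow, mul_pow, hωM, hωN, mul_one, mul_one]
      exact hI.1 hu
    have hIinv : ∀ u ∈ I, u * ω⁻¹ ∈ I := by
      intro u hu
      rw [hI, mul_pow, mul_pow, inv_pow, inv_pow, hωM, hωN, inv_one, mul_one, mul_one]
      exact hI.1 hu
    have hsum : ∑ u ∈ I, (classPart N p A u).sum = ω * ∑ u ∈ I, (classPart N p A u).sum := by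
      rw [Finset.mul_sum]
      symm
      refine Finset.sum_bij' (fun u _ => u * ω) (fun u _ => u * ω⁻¹) hIω hIinv
        (fun u _ => mul_inv_cancel_right₀ hω0 u) (fun u _ => inv_mul_cancel_right₀ hω0 u)
        fun u hu => ?_
      have := key hpr.pow_eq_one u
      rw [hD u hu, hD _ (hIω u hu), sub_zero, sub_zero] at this
      exact this.symm
    have hzero : (A.filter fun x => ¬ x ^ M = 1).sum = 0 := by
      rw [hfilter, Multiset.sum_sum]
      have : (1 - ω) * ∑ u ∈ I, (classPart N p A u).sum = 0 := by linear_combination hsum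
      exact (mul_eq_zero.1 this).resolve_left (sub_ne_zero.2 hω1.symm)
    refine ⟨A.filter (· ^ M = 1), fun x hx => (Multiset.mem_filter.1 hx).2, ?_,
      Multiset.card_le_card (Multiset.filter_le _ _)⟩
    have := congrArg Multiset.sum (Multiset.filter_add_not (· ^ M = 1) A)
    rwa [Multiset.sum_add, hzero, add_zero] at this
  · have hpp : ∀ x ∈ t, primaryPart N p x = 1 := by
      intro x hx
      have h1 : M ∣ ordCompl[p] N := by
        refine Nat.Coprime.dvd_of_dvd_mul_left (m := ordProj[p] N)
          (((Nat.Prime.coprime_iff_not_dvd hp).2 hpM).symm.pow_right _) ?_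
        rw [Nat.ordProj_mul_ordCompl_eq_self]
        exact dvd_mul_left M p
      obtain ⟨k, hk⟩ := h1.trans (ordCompl_dvd_primaryExponent (N := N) hp)
      rw [primaryPart, hk, pow_mul, hmemt.1 hx, one_pow]
    have hroot : ∀ {x : L}, x ^ N = 1 → primaryPart N p x = 1 → x ^ M = 1 := fun hx h => by
      rw [hMp hx, h, one_pow]
    have h1 := key hpr.pow_eq_one 1
    rw [one_mul, Finset.filter_true_of_mem hpp, ← hd, Finset.filter_false_of_mem
      fun x hx h => hω1 (h.symm.trans (hpp x hx)), Finset.sum_empty, sub_zero] at h1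
    refine ⟨classPart N p A 1 + (classPart N p A ω).map fun x => -(ω⁻¹ * x), ?_, ?_, ?_⟩
    · intro x hx
      rcases Multiset.mem_add.1 hx with hx | hx
      · obtain ⟨hxA, hx1⟩ := mem_classPart.1 hx
        exact hroot (hA x hxA) hx1
      · obtain ⟨y, hy, rfl⟩ := Multiset.mem_map.1 hx
        obtain ⟨hyA, hy1⟩ := mem_classPart.1 hy
        have hωp : (ω⁻¹) ^ p = 1 := by rw [inv_pow, hpr.pow_eq_one, inv_one]
        rw [(even_iff_two_dvd.2 hM2).neg_pow]
        apply hroot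
        · rw [mul_pow, hA y hyA, hNdef, pow_mul, hωp, one_pow, one_mul]
        · rw [primaryPart_mul, hy1, primaryPart_self hN hp hpN hωp, inv_mul_cancel₀ hω0]
    · rw [Multiset.sum_add, Multiset.sum_map_neg, Multiset.sum_map_mul_left, Multiset.map_id', h1]
      field_simp
      ring
    · have := Multiset.card_le_card (sum_classPart_le (N := N) (p := p) (A := A) {1, ω})
      rw [Finset.sum_pair hω1.symm, Multiset.card_add] at this
      rwa [Multiset.card_add, Multiset.card_map]

end Descent

section CyclotomicFields

theorem cycField_mono {m n : ℕ} (h : m ∣ n) : cycField m ≤ cycField n := by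
  obtain ⟨k, rfl⟩ := h
  refine Subfield.closure_mono fun z (hz : z ^ m = 1) => ?_
  rw [Set.mem_ofPred_eq, pow_mul, hz, one_pow]

theorem multiset_sum_mem_cycField {n : ℕ} {A : Multiset ℂ} (hA : ∀ x ∈ A, x ^ n = 1) :
    A.sum ∈ cycField n :=
  multiset_sum_mem _ fun x hx => Subfield.subset_closure (hA x hx)

theorem exists_coeff_of_mem_cycField {n : ℕ} (hn : n ≠ 0) {β : ℂ} (hβ : β ∈ cycField n) :
    ∃ d : ℂ → ℚ, β = ∑ y ∈ Polynomial.nthRootsFinset n (1 : ℂ), (d y : ℂ) * y := by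
  have hfin : {z : ℂ | z ^ n = 1} = Polynomial.nthRootsFinset n (1 : ℂ) := by
    ext z
    simp [Polynomial.mem_nthRootsFinset hn.bot_lt]
  have hmem : β ∈ IntermediateField.adjoin ℚ {z : ℂ | z ^ n = 1} := by
    refine (Subfield.closure_le (t := (IntermediateField.adjoin ℚ _).toSubfield)).2 ?_ hβ
    exact IntermediateField.subset_adjoin ℚ _
  have halg : ∀ z ∈ {z : ℂ | z ^ n = 1}, IsAlgebraic ℚ z := fun z hz =>
    (IsIntegral.of_pow hn.bot_lt (by rw [hz.out]; exact isIntegral_one)).isAlgebraic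
  rw [← IntermediateField.mem_toSubalgebra,
    IntermediateField.adjoin_toSubalgebra_of_isAlgebraic halg, ← Subalgebra.mem_toSubmodule,
    Algebra.adjoin_eq_span_of_subset, hfin, Submodule.mem_span_finset] at hmem
  · obtain ⟨d, -, hd⟩ := hmem
    exact ⟨d, by simp only [← hd, Algebra.smul_def, eq_ratCast]⟩
  · have hker : {z : ℂ | z ^ n = 1} = MonoidHom.mker (powMonoidHom n : ℂ →* ℂ) := by
      ext z
      simp [MonoidHom.mem_mker]
    rw [hker, Submonoid.closure_eq]
    exact Submodule.subset_span

/-- A sum of roots of unity lying in the `n`-th cyclotomic field is a sum of at most as many `n`-th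
roots of unity, if `n` is even. -/
theorem exists_multiset_of_sum_mem_cycField {n k : ℕ} (hn : n ≠ 0) (hn2 : 2 ∣ n) (hk : k ≠ 0)
    {A : Multiset ℂ} (hA : ∀ x ∈ A, x ^ (k * n) = 1) (hsum : A.sum ∈ cycField n) :
    ∃ B : Multiset ℂ, (∀ x ∈ B, x ^ n = 1) ∧ B.sum = A.sum ∧ B.card ≤ A.card := by
  induction k using induction_on_primes generalizing A with
  | zero => exact absurd rfl hk
  | one => exact ⟨A, by simpa using hA, rfl, le_rfl⟩
  | prime_mul p m hp ih =>
    have hm : m ≠ 0 := right_ne_zero_of_mul hk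
    have hM : m * n ≠ 0 := mul_ne_zero hm hn
    simp only [mul_assoc] at hA
    obtain ⟨d, hd⟩ := exists_coeff_of_mem_cycField hM (cycField_mono (Dvd.intro_left m rfl) hsum)
    obtain ⟨B, hB, hBsum, hBcard⟩ := exists_multiset_of_sum_mem_span hp hM (hn2.mul_left m)
      (Complex.isPrimitiveRoot_exp (p * (m * n)) (mul_ne_zero hp.ne_zero hM)) hA d hd
    obtain ⟨C, hC, hCsum, hCcard⟩ := ih hm hB (hBsum ▸ hsum)
    exact ⟨C, hC, hCsum.trans hBsum, hCcard.trans hBcard⟩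

theorem conductorOf_singleton_le {n : ℕ} (hn : n ≠ 0) {β : ℂ} (hβ : β ∈ cycField n) :
    conductorOf {β} ≤ n :=
  Nat.sInf_le ⟨hn.bot_lt, by simpa using hβ⟩

theorem conductorOf_singleton_spec {n : ℕ} (hn : n ≠ 0) {β : ℂ} (hβ : β ∈ cycField n) :
    conductorOf {β} ≠ 0 ∧ β ∈ cycField (conductorOf {β}) := by
  have h : conductorOf {β} ∈ {n : ℕ | 0 < n ∧ {β} ⊆ (cycField n : Set ℂ)} :=
    Nat.sInf_mem ⟨n, hn.bot_lt, by simpa using hβ⟩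
  exact ⟨h.1.ne', by simpa using h.2⟩

/-- A field containing a primitive `c`-th root of unity contains a primitive `N`-th root of unity
for some even multiple `N ≤ 2 * c` of `c`. -/
theorem exists_even_multiple_isPrimitiveRoot {L : Type*} [Field L] [CharZero L] {c : ℕ}
    (hc : c ≠ 0) {ζ : L} (hζ : IsPrimitiveRoot ζ c) :
    ∃ N : ℕ, N ≠ 0 ∧ 2 ∣ N ∧ c ∣ N ∧ N ≤ 2 * c ∧ ∃ ξ : L, IsPrimitiveRoot ξ N := by
  rcases Nat.even_or_odd c with h | h
  · exact ⟨c, hc, h.two_dvd, dvd_rfl, by omega, ζ, hζ⟩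
  · refine ⟨2 * c, by omega, Dvd.intro _ rfl, Dvd.intro_left _ rfl, le_rfl, -1 * ζ, ?_⟩
    have h2 : IsPrimitiveRoot (-1 : L) 2 := IsPrimitiveRoot.neg_one 0 (by norm_num)
    have := (Commute.all (-1 : L) ζ).orderOf_mul_eq_mul_orderOf_of_coprime
      (by rw [← h2.eq_orderOf, ← hζ.eq_orderOf]; exact h.coprime_two_left)
    rw [← h2.eq_orderOf, ← hζ.eq_orderOf] at this
    exact this ▸ IsPrimitiveRoot.orderOf _

/-- An automorphism of a cyclotomic field fixing all summands in a representation of `β` as a sum of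
roots of unity fixes the roots of unity of order the conductor of `β`. -/
theorem apply_eq_of_forall_mem_apply_eq {F : Type*} {E : Type*} [Field F] [Field E] [Algebra F E]
    (f : E →+* ℂ) {c N : ℕ} {A : Multiset E} (hc : c = conductorOf {f A.sum}) (hN : N ≠ 0)
    (hcN : c ∣ N) (hN2c : N ≤ 2 * c) {ξ : E} (hξ : IsPrimitiveRoot ξ N)
    (hA : ∀ x ∈ A, x ^ N = 1) {τ : E ≃ₐ[F] E} (hτ : ∀ x ∈ A, τ x = x)
    {ζ : E} (hζ : ζ ^ c = 1) : τ ζ = ζ := by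
  have : NeZero N := ⟨hN⟩
  obtain ⟨s, -, hs⟩ := hξ.eq_pow_of_pow_eq_one (ξ := τ ξ)
    (by rw [← map_pow, hξ.pow_eq_one, map_one])
  have hpow : ∀ x : E, x ^ N = 1 → τ x = x * x ^ (s + N - 1) := by
    intro x hx
    obtain ⟨i, -, rfl⟩ := hξ.eq_pow_of_pow_eq_one hx
    rw [map_pow, ← hs, ← pow_succ', Nat.sub_add_cancel (by omega), pow_add, hx, mul_one,
      pow_right_comm]
  have hg : N.gcd (s + N - 1) ≠ 0 := Nat.gcd_ne_zero_left hN
  have hle : c ≤ N.gcd (s + N - 1) := by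
    rw [hc]
    refine conductorOf_singleton_le hg ?_
    rw [map_multiset_sum]
    refine multiset_sum_mem_cycField fun y hy => ?_
    obtain ⟨x, hx, rfl⟩ := Multiset.mem_map.1 hy
    have hx0 : x ≠ 0 := ne_zero_of_pow_eq_one hN (hA x hx)
    rw [← map_pow, pow_gcd_eq_one.2 ⟨hA x hx, ?_⟩, map_one]
    have := hpow x (hA x hx)
    rw [hτ x hx] at this
    exact mul_left_cancel₀ hx0 (by rw [← this, mul_one])
  have hdvd : c ∣ N.gcd (s + N - 1) := by
    obtain ⟨k, hk⟩ := Nat.gcd_dvd_left N (s + N - 1)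
    generalize N.gcd (s + N - 1) = g at *
    have hk2 : k ≤ 2 := by
      by_contra! h
      nlinarith [Nat.pos_of_ne_zero hg]
    obtain ⟨j, rfl⟩ := hcN
    interval_cases k
    · omega
    · exact ⟨j, by omega⟩
    · have : g = c := by omega
      rw [this]
  obtain ⟨m, hm⟩ := hdvd.trans (Nat.gcd_dvd_right N (s + N - 1))
  obtain ⟨j, rfl⟩ := hcN
  rw [hpow ζ (by rw [pow_mul, hζ, one_pow]), hm, pow_mul, hζ, one_pow, mul_one]

end CyclotomicFields

/-- If `β` is a sum of four roots of unity, then `[ℚ(ζ_{c(β)}) : ℚ(β)] ≤ 6`.  Here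
`ℚ(ζ_{c(β)})` is realized as `ℚ(β)(ζ)` for `ζ` a primitive `c(β)`-th root of unity
(these fields agree, since `β ∈ ℚ(ζ_{c(β)})`). -/
theorem degree_le_six_of_sum_four_roots (η₁ η₂ η₃ η₄ : ℂ)
    (h₁ : IsRootOfUnity η₁) (h₂ : IsRootOfUnity η₂)
    (h₃ : IsRootOfUnity η₃) (h₄ : IsRootOfUnity η₄)
    (β : ℂ) (hβ : β = η₁ + η₂ + η₃ + η₄)
    (ζ : ℂ) (hζ : IsPrimitiveRoot ζ (conductorOf {β})) :
    Module.finrank (IntermediateField.adjoin ℚ {β})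
      (IntermediateField.adjoin (IntermediateField.adjoin ℚ {β}) {ζ}) ≤ 6 := by
  obtain ⟨n₁, hn₁, h₁⟩ := h₁
  obtain ⟨n₂, hn₂, h₂⟩ := h₂
  obtain ⟨n₃, hn₃, h₃⟩ := h₃
  obtain ⟨n₄, hn₄, h₄⟩ := h₄
  obtain ⟨k, hk, A, hA, hAsum, hAcard⟩ : ∃ k ≠ 0, ∃ A : Multiset ℂ,
      (∀ x ∈ A, x ^ k = 1) ∧ A.sum = β ∧ A.card = 4 := by
    refine ⟨n₁ * n₂ * n₃ * n₄, by positivity, {η₁, η₂, η₃, η₄}, ?_, ?_, rfl⟩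
    · have : ∀ {x : ℂ} {m k : ℕ}, x ^ m = 1 → m ∣ k → x ^ k = 1 := fun hx ⟨j, hj⟩ => by
        rw [hj, pow_mul, hx, one_pow]
      simp only [Multiset.insert_eq_cons, Multiset.mem_cons, Multiset.mem_singleton]
      rintro x (rfl | rfl | rfl | rfl)
      · exact this h₁ ⟨n₂ * n₃ * n₄, by ring⟩
      · exact this h₂ ⟨n₁ * n₃ * n₄, by ring⟩
      · exact this h₃ ⟨n₁ * n₂ * n₄, by ring⟩
      · exact this h₄ ⟨n₁ * n₂ * n₃, by ring⟩
    · simp [hβ, add_assoc]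
  obtain ⟨hc, hβc⟩ := conductorOf_singleton_spec hk (hAsum ▸ multiset_sum_mem_cycField hA)
  have : NeZero (conductorOf {β}) := ⟨hc⟩
  set F := IntermediateField.adjoin ℚ {β}
  set E := IntermediateField.adjoin F {ζ} with hE
  have : IsCyclotomicExtension {conductorOf {β}} F E :=
    (IntermediateField.isCyclotomicExtension_singleton_iff_eq_adjoin _ _ _ E hζ).2 hE
  have := IsCyclotomicExtension.finiteDimensional {conductorOf {β}} F E
  have := IsCyclotomicExtension.isGalois {conductorOf {β}} F E
  have := IsCyclotomicExtension.isMulCommutative {conductorOf {β}} F E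
  rw [← IsGalois.card_aut_eq_finrank]
  let ζE : E := ⟨ζ, IntermediateField.mem_adjoin_simple_self F ζ⟩
  have hζE : IsPrimitiveRoot ζE (conductorOf {β}) :=
    IsPrimitiveRoot.of_map_of_injective (f := algebraMap E ℂ) hζ (algebraMap E ℂ).injective
  obtain ⟨N, hN, hN2, hcN, hN2c, ξ, hξ⟩ := exists_even_multiple_isPrimitiveRoot hc hζE
  have : NeZero N := ⟨hN⟩
  obtain ⟨B, hB, hBsum, hBcard⟩ := exists_multiset_of_sum_mem_cycField hN hN2 hk
    (fun x hx => by rw [pow_mul, hA x hx, one_pow]) (hAsum ▸ cycField_mono hcN hβc)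
  obtain ⟨B, rfl⟩ : ∃ B' : Multiset E, B'.map (algebraMap E ℂ) = B := by
    have hlift : ∀ x ∈ B, ∃ y : E, algebraMap E ℂ y = x := fun x hx => by
      obtain ⟨i, -, hi⟩ := (hξ.map_of_injective (algebraMap E ℂ).injective).eq_pow_of_pow_eq_one
        (hB x hx)
      exact ⟨ξ ^ i, by rw [map_pow, hi]⟩
    choose! g hg using hlift
    refine ⟨B.map g, ?_⟩
    rw [Multiset.map_map]
    exact (Multiset.map_congr rfl hg).trans B.map_id
  obtain ⟨A', hA', hA'sum, hA'card⟩ := exists_isMinimalRep (N := N) (A := B) fun x hx =>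
    (algebraMap E ℂ).injective (by
      rw [map_pow, map_one]; exact hB _ (Multiset.mem_map_of_mem _ hx))
  have hsum : algebraMap E ℂ A'.sum = β := by
    rw [hA'sum, map_multiset_sum, hBsum, hAsum]
  refine hA'.card_aut_le_six ?_ hN hN2 hξ (fun σ τ => mul_comm' σ τ) (fun σ => ?_)
    fun τ hτ => ?_
  · rw [Multiset.card_map] at hBcard
    omega
  · have : A'.sum = algebraMap F E ⟨β, IntermediateField.mem_adjoin_simple_self ℚ β⟩ :=
      (algebraMap E ℂ).injective hsum
    rw [this, AlgEquiv.commutes]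
  · refine IsCyclotomicExtension.algEquiv_eq_of_apply_eq {conductorOf {β}} F E ?_
    rintro _ rfl -
    exact ⟨ζE, hζE, apply_eq_of_forall_mem_apply_eq (algebraMap E ℂ) (by rw [hsum]) hN hcN hN2c hξ
      hA'.pow_eq_one hτ hζE.pow_eq_one⟩
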